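/- arXiv:2307.01839 — 3 statements merged into one kernel-verified Lean document; each statement's English description precedes it below -/
import Mathlib

section
/- For d ≥ 2, κ_i > −1 (i = 1,…,d+1), n ∈ ℕ_0 and 1 ≤ ℓ ≤ d: every polynomial f in d variables of degree at most n satisfies ‖ √(x_ℓ(1−|x|)) ∂_ℓ f ‖_{κ,2}² + Σ_{j=1, j≠ℓ}^d ‖ √(x_ℓ x_j) ∂_{ℓ,j} f ‖_{κ,2}² ≤ n(n+|κ|+d) ‖f‖_{κ,2}², and this inequality is sharp: there exists a nonzero polynomial f of degree exactly n for which equality holds. -/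
open MeasureTheory Finset

noncomputable section

/-- The simplex `△^d = {x : x_i ≥ 0, x_1 + ⋯ + x_d ≤ 1}`. -/
def Splx (d : ℕ) : Set (Fin d → ℝ) := {x | (∀ i, 0 ≤ x i) ∧ ∑ i, x i ≤ 1}

/-- The `i`-th partial derivative. -/
def pd {d : ℕ} (i : Fin d) (f : (Fin d → ℝ) → ℝ) : (Fin d → ℝ) → ℝ :=
  fun x => fderiv ℝ f x (Pi.single i 1)

/-- `∂_{i,j} = ∂_i - ∂_j`. -/
def pdd {d : ℕ} (i j : Fin d) (f : (Fin d → ℝ) → ℝ) : (Fin d → ℝ) → ℝ :=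
  fun x => pd i f x - pd j f x

/-- `⟨x,∇⟩ = ∑ x_i ∂_i`. -/
def xgrad {d : ℕ} (f : (Fin d → ℝ) → ℝ) : (Fin d → ℝ) → ℝ :=
  fun x => ∑ i, x i * pd i f x

/-- The Jacobi weight `W_κ(x) = x_1^{κ_1} ⋯ x_d^{κ_d} (1-|x|)^{κ_{d+1}}`. -/
def Wk {d : ℕ} (κ : Fin (d+1) → ℝ) (x : Fin d → ℝ) : ℝ :=
  (∏ i : Fin d, x i ^ κ i.castSucc) * (1 - ∑ i, x i) ^ κ (Fin.last d)

/-- The spectral operator `D_κ`. -/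
def Dk {d : ℕ} (κ : Fin (d+1) → ℝ) (f : (Fin d → ℝ) → ℝ) (x : Fin d → ℝ) : ℝ :=
  (∑ i, x i * (1 - x i) * pd i (pd i f) x)
    - 2 * ∑ i, ∑ j ∈ Finset.univ.filter (fun j => i < j), x i * x j * pd i (pd j f) x
    + ∑ i, (κ i.castSucc + 1 - ((∑ k, κ k) + (d : ℝ) + 1) * x i) * pd i f x

/-- The normalizing constant `b_κ`. -/
def bk {d : ℕ} (κ : Fin (d+1) → ℝ) : ℝ :=
  Real.Gamma ((∑ i, κ i) + (d : ℝ) + 1) / ∏ i, Real.Gamma (κ i + 1)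

/-- The inner product `⟨f,g⟩_κ = b_κ ∫_{△^d} f g W_κ`. -/
def ipk {d : ℕ} (κ : Fin (d+1) → ℝ) (f g : (Fin d → ℝ) → ℝ) : ℝ :=
  bk κ * ∫ x in Splx d, f x * g x * Wk κ x

/-- The norm `‖f‖_{κ,2}`. -/
def nrm2 {d : ℕ} (κ : Fin (d+1) → ℝ) (f : (Fin d → ℝ) → ℝ) : ℝ :=
  Real.sqrt (ipk κ f f)

/-- Membership in `V_n^d(W_κ)`: a polynomial of degree (at most) `n` orthogonal to all
polynomials of lower degree. -/
def InVn (d n : ℕ) (κ : Fin (d+1) → ℝ) (f : MvPolynomial (Fin d) ℝ) : Prop :=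
  f.totalDegree ≤ n ∧ ∀ g : MvPolynomial (Fin d) ℝ, g.totalDegree < n →
    ipk κ (fun x => MvPolynomial.eval x f) (fun x => MvPolynomial.eval x g) = 0

/-- `x_k` for `1 ≤ k ≤ d+1`, with the convention `x_{d+1} = 1 - |x|`. -/
def xe {d : ℕ} (x : Fin d → ℝ) (k : Fin (d+1)) : ℝ :=
  if h : (k : ℕ) < d then x ⟨(k : ℕ), h⟩ else 1 - ∑ i, x i

/-- The quantity `‖√(x_ℓ(1-|x|)) ∂_ℓ f‖²_{κ,2} + Σ_{j ≠ ℓ} ‖√(x_ℓ x_j) ∂_{ℓ,j} f‖²_{κ,2}`. -/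
def lform {d : ℕ} (κ : Fin (d+1) → ℝ) (l : Fin d) (F : (Fin d → ℝ) → ℝ) : ℝ :=
  nrm2 κ (fun x => Real.sqrt (x l * (1 - ∑ k, x k)) * pd l F x) ^ 2 +
  ∑ j ∈ Finset.univ.filter (fun j => j ≠ l),
    nrm2 κ (fun x => Real.sqrt (x l * x j) * pdd l j F x) ^ 2

theorem xe_castSucc {d : ℕ} (x : Fin d → ℝ) (i : Fin d) : xe x i.castSucc = x i := by
  simp [xe]

theorem xe_last {d : ℕ} (x : Fin d → ℝ) : xe x (Fin.last d) = 1 - ∑ i, x i := by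
  simp [xe]

theorem sum_xe {d : ℕ} (x : Fin d → ℝ) : ∑ k, xe x k = 1 := by
  simp [Fin.sum_univ_castSucc, xe_castSucc, xe_last]

theorem mem_Splx_iff {d : ℕ} {x : Fin d → ℝ} : x ∈ Splx d ↔ ∀ k, 0 ≤ xe x k := by
  simp [Splx, Fin.forall_fin_succ', xe_castSucc, xe_last]

theorem Wk_eq_prod {d : ℕ} (κ : Fin (d+1) → ℝ) (x : Fin d → ℝ) :
    Wk κ x = ∏ k, xe x k ^ κ k := by
  simp [Wk, Fin.prod_univ_castSucc, xe_castSucc, xe_last]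

theorem continuous_xe {d : ℕ} (k : Fin (d+1)) : Continuous fun x : Fin d → ℝ => xe x k := by
  refine Fin.lastCases ?_ (fun i => ?_) k
  · simp only [xe_last]; fun_prop
  · simp only [xe_castSucc]; fun_prop

theorem isClosed_Splx (d : ℕ) : IsClosed (Splx d) := by
  have : Splx d = ⋂ k, {x | 0 ≤ xe x k} := by ext x; simp [mem_Splx_iff]
  rw [this]
  exact isClosed_iInter fun k => isClosed_le continuous_const (continuous_xe k)

theorem isCompact_Splx (d : ℕ) : IsCompact (Splx d) := by
  refine (isCompact_univ_pi (s := fun _ : Fin d => Set.Icc (0 : ℝ) 1)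
    fun _ => isCompact_Icc).of_isClosed_subset (isClosed_Splx d) ?_
  rintro x ⟨h0, h1⟩ i -
  exact ⟨h0 i, (single_le_sum (fun j _ => h0 j) (mem_univ i)).trans h1⟩

/-- The affine involution of the simplex that exchanges `x_k` and `1 - |x|`. -/
def swapLast {d : ℕ} (k : Fin d) (x : Fin d → ℝ) : Fin d → ℝ :=
  Function.update x k (1 - ∑ i, x i)

theorem xe_swapLast {d : ℕ} (k : Fin d) (x : Fin d → ℝ) (j : Fin (d+1)) :
    xe (swapLast k x) j = xe x (Equiv.swap k.castSucc (Fin.last d) j) := by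
  refine Fin.lastCases ?_ (fun i => ?_) j
  · rw [Equiv.swap_apply_right, xe_castSucc, xe_last, swapLast, sum_update_of_mem (mem_univ k),
      ← add_sum_erase univ x (mem_univ k), sdiff_singleton_eq_erase]
    ring
  · rw [xe_castSucc, swapLast]
    rcases eq_or_ne i k with rfl | h
    · rw [Equiv.swap_apply_left, xe_last, Function.update_self]
    · rw [Function.update_of_ne h, Equiv.swap_apply_of_ne_of_ne (by simpa using h)
        (Fin.castSucc_ne_last i), xe_castSucc]

theorem measurePreserving_swapLast {d : ℕ} (k : Fin d) :
    MeasurePreserving (swapLast k) := by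
  let M : Matrix (Fin d) (Fin d) ℝ := (1 : Matrix (Fin d) (Fin d) ℝ).updateRow k (fun _ => -1)
  have hdet : M.det = -1 := by
    rw [← Matrix.det_transpose, ← Matrix.updateCol_transpose, Matrix.transpose_one,
      ← Matrix.cramer_apply, Matrix.cramer_one]
    rfl
  have hM : MeasurePreserving (Matrix.toLin' M) := by
    refine ⟨(LinearMap.continuous_on_pi _).measurable, ?_⟩
    rw [Real.map_matrix_volume_pi_eq_smul_volume_pi (by rw [hdet]; norm_num), hdet]
    simp
  have h := (measurePreserving_add_left volume (Pi.single k (1 : ℝ))).comp hM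
  have e : swapLast k = (fun x => Pi.single k 1 + x) ∘ Matrix.toLin' M := ?_
  · rwa [e]
  refine funext fun x => funext fun j => ?_
  rcases eq_or_ne j k with rfl | hj
  · simp [swapLast, M, Matrix.mulVec, dotProduct, sub_eq_add_neg]
  · simp [swapLast, M, Matrix.mulVec, hj, dotProduct, Matrix.one_apply]

theorem integrableOn_Wk_of_le_last {d : ℕ} {κ : Fin (d+1) → ℝ} (hκ : ∀ i, -1 < κ i) {δ : ℝ}
    (hδ : 0 < δ) : IntegrableOn (Wk κ) {x ∈ Splx d | δ ≤ xe x (Fin.last d)} := by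
  have hm : MeasurableSet {x ∈ Splx d | δ ≤ xe x (Fin.last d)} :=
    (isClosed_Splx d).measurableSet.inter
      (measurableSet_le measurable_const (continuous_xe _).measurable)
  have h1 : IntegrableOn (fun x : Fin d → ℝ => ∏ i, x i ^ κ i.castSucc)
      (Set.univ.pi fun _ => Set.Icc (0 : ℝ) 1) := by
    rw [IntegrableOn, volume_pi, Measure.restrict_pi_pi]
    refine Integrable.fintype_prod (f := fun (i : Fin d) (t : ℝ) => t ^ κ i.castSucc) fun i => ?_
    exact (intervalIntegrable_iff_integrableOn_Icc_of_le zero_le_one).1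
      (intervalIntegral.intervalIntegrable_rpow' (hκ _))
  have h2 : IntegrableOn (fun x : Fin d → ℝ => ∏ i, x i ^ κ i.castSucc)
      {x ∈ Splx d | δ ≤ xe x (Fin.last d)} := by
    refine h1.mono_set ?_
    rintro x ⟨⟨h0, h1⟩, -⟩ i -
    exact ⟨h0 i, (single_le_sum (fun j _ => h0 j) (mem_univ i)).trans h1⟩
  refine Integrable.mul_bdd (c := 1 + δ ^ κ (Fin.last d)) h2 ?_ ?_
  · exact Measurable.aestronglyMeasurable (by fun_prop)
  · refine (ae_restrict_mem hm).mono ?_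
    rintro x ⟨⟨h0, h1⟩, hx⟩
    rw [xe_last] at hx
    have hpos : 0 < 1 - ∑ i, x i := hδ.trans_le hx
    have hle : 1 - ∑ i, x i ≤ 1 := by
      have := sum_nonneg fun i (_ : i ∈ univ) => h0 i
      linarith
    rw [Real.norm_of_nonneg (by positivity)]
    rcases le_total 0 (κ (Fin.last d)) with hk | hk
    · have := Real.rpow_le_one hpos.le hle hk
      have : 0 < δ ^ κ (Fin.last d) := by positivity
      linarith
    · have := Real.rpow_le_rpow_of_nonpos hδ hx hk
      linarith

theorem integrableOn_Wk {d : ℕ} {κ : Fin (d+1) → ℝ} (hκ : ∀ i, -1 < κ i) :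
    IntegrableOn (Wk κ) (Splx d) := by
  set δ : ℝ := 1 / (d + 1) with hδ_def
  have hδ : 0 < δ := by positivity
  have hm : ∀ k, MeasurableSet {x ∈ Splx d | δ ≤ xe x k} := fun k =>
    (isClosed_Splx d).measurableSet.inter
      (measurableSet_le measurable_const (continuous_xe _).measurable)
  have hcover : Splx d ⊆ ⋃ k, {x ∈ Splx d | δ ≤ xe x k} := by
    intro x hx
    by_contra hcon
    simp only [Set.mem_iUnion, Set.mem_ofPred_eq, not_exists, not_and, not_le] at hcon
    have : ∑ k, xe x k < ∑ _k : Fin (d+1), δ :=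
      sum_lt_sum_of_nonempty univ_nonempty fun k _ => hcon k hx
    rw [sum_xe, sum_const, card_univ, Fintype.card_fin, nsmul_eq_mul, hδ_def] at this
    push_cast at this
    rw [mul_one_div_cancel (by positivity)] at this
    exact lt_irrefl _ this
  refine IntegrableOn.mono_set (integrableOn_finite_iUnion.2 fun k => ?_) hcover
  refine Fin.lastCases (integrableOn_Wk_of_le_last hκ hδ) (fun i => ?_) k
  have h := integrableOn_Wk_of_le_last
    (κ := κ ∘ Equiv.swap i.castSucc (Fin.last d)) (fun j => hκ _) hδ
  rw [← integrable_indicator_iff (hm _)] at h ⊢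
  convert (measurePreserving_swapLast i).integrable_comp_of_integrable h using 1
  ext x
  have hW : Wk (κ ∘ Equiv.swap i.castSucc (Fin.last d)) (swapLast i x) = Wk κ x := by
    simp only [Wk_eq_prod, xe_swapLast, Function.comp_apply]
    exact Equiv.prod_comp (Equiv.swap i.castSucc (Fin.last d)) fun j => xe x j ^ κ j
  have hS : swapLast i x ∈ {x ∈ Splx d | δ ≤ xe x (Fin.last d)} ↔
      x ∈ {x ∈ Splx d | δ ≤ xe x i.castSucc} := by
    simp only [Set.mem_ofPred_eq, mem_Splx_iff, xe_swapLast, Equiv.swap_apply_right]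
    rw [(Equiv.swap i.castSucc (Fin.last d)).forall_congr_left]
    simp
  by_cases hx : x ∈ {x ∈ Splx d | δ ≤ xe x i.castSucc}
  · rw [Function.comp_apply, Set.indicator_of_mem hx, Set.indicator_of_mem (hS.2 hx), hW]
  · rw [Function.comp_apply, Set.indicator_of_notMem hx,
      Set.indicator_of_notMem (mt hS.1 hx)]

theorem intervalIntegral_beta_derivative {a b c : ℝ} (ha : -1 < a) (hb : -1 < b) (hc : 0 ≤ c) :
    ∫ t in (0 : ℝ)..c, ((a + 1) * (c - t) - (b + 1) * t) * (t ^ a * (c - t) ^ b) = 0 := by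
  by_cases hint : IntervalIntegrable
      (fun t => ((a + 1) * (c - t) - (b + 1) * t) * (t ^ a * (c - t) ^ b)) volume 0 c
  swap
  · exact intervalIntegral.integral_undef hint
  rw [intervalIntegral.integral_eq_sub_of_hasDerivAt_of_le
    (f := fun t => t ^ (a + 1) * (c - t) ^ (b + 1)) hc _ _ hint]
  · simp [Real.zero_rpow (by linarith : a + 1 ≠ 0), Real.zero_rpow (by linarith : b + 1 ≠ 0)]
  · refine ContinuousOn.mul ?_ ?_
    · exact continuousOn_id.rpow_const fun x _ => Or.inr (by linarith)
    · exact (continuousOn_const.sub continuousOn_id).rpow_const fun x _ => Or.inr (by linarith)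
  · rintro t ⟨h0, h1⟩
    have hs : 0 < c - t := by linarith
    have e1 := Real.hasDerivAt_rpow_const (x := t) (p := a + 1) (Or.inl h0.ne')
    have e2 := ((hasDerivAt_id t).const_sub c).rpow_const (p := b + 1) (Or.inl hs.ne')
    refine (e1.mul e2).congr_deriv ?_
    simp only [id, add_sub_cancel_right]
    rw [Real.rpow_add_one h0.ne', Real.rpow_add_one hs.ne']
    ring

theorem integral_Wk_stokes {d : ℕ} {κ : Fin (d+1) → ℝ} (hκ : ∀ i, -1 < κ i) (i : Fin d) :
    ∫ x in Splx d, ((κ i.castSucc + 1) * xe x (Fin.last d)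
      - (κ (Fin.last d) + 1) * xe x i.castSucc) * Wk κ x = 0 := by
  obtain ⟨m, rfl⟩ : ∃ m, d = m + 1 := ⟨d - 1, by have := i.pos; omega⟩
  have hSm := (isClosed_Splx (m+1)).measurableSet
  rw [← integral_indicator hSm]
  set F := (Splx (m+1)).indicator fun x => ((κ i.castSucc + 1) * xe x (Fin.last (m+1))
      - (κ (Fin.last (m+1)) + 1) * xe x i.castSucc) * Wk κ x with hF
  have hmp := (volume_preserving_piFinSuccAbove (fun _ : Fin (m+1) => ℝ) i).symm
  rw [← hmp.integral_comp']
  by_cases hint : Integrable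
      (fun z => F ((MeasurableEquiv.piFinSuccAbove (fun _ : Fin (m+1) => ℝ) i).symm z))
      (volume.prod volume : Measure (ℝ × (Fin m → ℝ)))
  swap
  · exact integral_undef hint
  rw [Measure.volume_eq_prod, integral_prod_symm _ hint]
  refine integral_eq_zero_of_ae (Filter.Eventually.of_forall fun y => ?_)
  set c := 1 - ∑ j, y j with hc_def
  have key : ∀ t : ℝ, F ((MeasurableEquiv.piFinSuccAbove (fun _ : Fin (m+1) => ℝ) i).symm (t, y))
      = (if ∀ j, 0 ≤ y j then ∏ j, y j ^ κ (i.succAbove j).castSucc else 0) *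
        (Set.Icc 0 c).indicator (fun t => ((κ i.castSucc + 1) * (c - t)
          - (κ (Fin.last (m+1)) + 1) * t) *
          (t ^ κ i.castSucc * (c - t) ^ κ (Fin.last (m+1)))) t := by
    intro t
    have e : (MeasurableEquiv.piFinSuccAbove (fun _ : Fin (m+1) => ℝ) i).symm (t, y)
      = i.insertNth t y := rfl
    have hsum : 1 - ∑ j, (i.insertNth t y : Fin (m+1) → ℝ) j = c - t := by
      simp [Fin.sum_univ_succAbove _ i, hc_def]; ring
    have hmem : (i.insertNth t y : Fin (m+1) → ℝ) ∈ Splx (m+1) ↔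
        (∀ j, 0 ≤ y j) ∧ t ∈ Set.Icc 0 c := by
      rw [mem_Splx_iff, Fin.forall_fin_succ', xe_last, hsum]
      simp only [xe_castSucc]
      rw [Fin.forall_iff_succAbove i]
      simp only [Fin.insertNth_apply_same, Fin.insertNth_apply_succAbove, Set.mem_Icc, sub_nonneg]
      tauto
    rw [e, hF]
    simp only [Set.indicator, hmem, xe_last, xe_castSucc, Wk, hsum, Fin.insertNth_apply_same,
      Fin.prod_univ_succAbove _ i, Fin.insertNth_apply_succAbove]
    by_cases h1 : ∀ j, 0 ≤ y j <;> by_cases h2 : t ∈ Set.Icc 0 c <;> simp [h1, h2]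
    ring
  simp only [key, Pi.zero_apply]
  rw [integral_const_mul, integral_indicator measurableSet_Icc]
  rcases le_or_gt 0 c with hc | hc
  · rw [integral_Icc_eq_integral_Ioc, ← intervalIntegral.integral_of_le hc,
      intervalIntegral_beta_derivative (hκ _) (hκ _) hc, mul_zero]
  · simp [Set.Icc_eq_empty_of_lt hc]

section TriangularOperator

variable {E : Type*} [AddCommGroup E] [Module ℝ E] {T : E →ₗ[ℝ] E} {P : ℕ → Submodule ℝ E}
  {ev : ℕ → ℝ}

theorem exists_resolvent_of_triangular (hP : Monotone P) (hP0 : P 0 = ⊥) (hev : StrictMono ev)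
    (hT : ∀ n, ∀ f ∈ P (n + 1), T f - ev n • f ∈ P n) {m n : ℕ} (hmn : m ≤ n) :
    ∀ r ∈ P m, ∃ h ∈ P m, T h - ev n • h = r := by
  induction m with
  | zero =>
    intro r hr
    rw [hP0, Submodule.mem_bot] at hr
    exact ⟨0, zero_mem _, by simp [hr]⟩
  | succ m ih =>
    intro r hr
    obtain ⟨h, hh, hhr⟩ := ih (by omega) _ (hT m r hr)
    have hne : ev m - ev n ≠ 0 := sub_ne_zero.2 (hev (by omega)).ne
    refine ⟨(ev m - ev n)⁻¹ • (r - h),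
      Submodule.smul_mem _ _ (sub_mem hr (hP (Nat.le_succ m) hh)), ?_⟩
    rw [map_smul, smul_comm (ev n), ← smul_sub, inv_smul_eq_iff₀ hne, map_sub]
    calc T r - T h - ev n • (r - h) = T r - ev n • r - (T h - ev n • h) := by module
      _ = (ev m - ev n) • r := by rw [hhr]; module

theorem exists_eigenvector_of_triangular (hP : Monotone P) (hP0 : P 0 = ⊥) (hev : StrictMono ev)
    (hT : ∀ n, ∀ f ∈ P (n + 1), T f - ev n • f ∈ P n) {n : ℕ} {f : E} (hf : f ∈ P (n + 1)) :
    ∃ h ∈ P n, T (f - h) = ev n • (f - h) := by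
  obtain ⟨h, hh, hhr⟩ := exists_resolvent_of_triangular hP hP0 hev hT le_rfl _ (hT n f hf)
  refine ⟨h, hh, ?_⟩
  rw [map_sub, smul_sub, ← sub_eq_zero]
  rw [← sub_eq_zero] at hhr
  rw [← neg_eq_zero, ← hhr]
  abel

theorem eigenvector_orthogonal_of_triangular (hP : Monotone P) (hP0 : P 0 = ⊥)
    (hev : StrictMono ev) (hT : ∀ n, ∀ f ∈ P (n + 1), T f - ev n • f ∈ P n)
    {B : LinearMap.BilinForm ℝ E} (hTB : ∀ f g, B (T f) g = B f (T g)) {n : ℕ} {g : E}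
    (hg : T g = ev n • g) {m : ℕ} (hmn : m ≤ n) : ∀ h ∈ P m, B g h = 0 := by
  induction m with
  | zero =>
    intro h hh
    rw [hP0, Submodule.mem_bot] at hh
    simp [hh]
  | succ m ih =>
    intro f hf
    obtain ⟨h, hh, hfh⟩ := exists_eigenvector_of_triangular hP hP0 hev hT hf
    have h1 := hTB g (f - h)
    rw [hg, hfh, map_smul, map_smul, LinearMap.smul_apply, smul_eq_mul, smul_eq_mul] at h1
    have h2 : ev m < ev n := hev (by omega)
    have h3 : B g (f - h) = 0 := by
      have : (ev n - ev m) * B g (f - h) = 0 := by linarith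
      exact (mul_eq_zero.1 this).resolve_left (by linarith)
    rw [map_sub, ih (by omega) h hh, sub_zero] at h3
    exact h3

theorem rayleigh_le_of_triangular (hP : Monotone P) (hP0 : P 0 = ⊥)
    (hev : StrictMono ev) (hT : ∀ n, ∀ f ∈ P (n + 1), T f - ev n • f ∈ P n)
    {B : LinearMap.BilinForm ℝ E} (hTB : ∀ f g, B (T f) g = B f (T g))
    (hB : ∀ f g, B f g = B g f) (hpos : ∀ f, 0 ≤ B f f) (n : ℕ) :
    ∀ f ∈ P (n + 1), B (T f) f ≤ ev n * B f f := by
  induction n with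
  | zero =>
    intro f hf
    have h := hT 0 f hf
    rw [hP0, Submodule.mem_bot, sub_eq_zero] at h
    simp [h]
  | succ n ih =>
    intro f hf
    obtain ⟨h, hh, hfh⟩ := exists_eigenvector_of_triangular hP hP0 hev hT hf
    obtain ⟨g, hg⟩ : ∃ g, g = f - h := ⟨_, rfl⟩
    rw [← hg] at hfh
    have hgh : B g h = 0 :=
      eigenvector_orthogonal_of_triangular hP hP0 hev hT hTB hfh le_rfl h hh
    have hhg : B h g = 0 := by rw [hB, hgh]
    have hThg : B (T h) g = 0 := by rw [hTB, hfh, map_smul, hhg, smul_zero]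
    have hf' : f = g + h := by rw [hg]; abel
    have hle := ih h hh
    have hlt : ev n < ev (n + 1) := hev (Nat.lt_succ_self n)
    have hTf : T f = ev (n + 1) • g + T h := by rw [hf', map_add, hfh]
    rw [hTf, hf']
    simp only [map_add, map_smul, LinearMap.add_apply, LinearMap.smul_apply, smul_eq_mul, hgh, hhg,
      hThg]
    nlinarith [hpos h]

end TriangularOperator

section BarycentricPolynomials

open MvPolynomial

variable {d : ℕ}

/-- The barycentric coordinates `x_1, …, x_d, 1 - |x|` as polynomials. -/
def baryX (k : Fin (d+1)) : MvPolynomial (Fin d) ℝ :=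
  Fin.snoc (α := fun _ => MvPolynomial (Fin d) ℝ) X (1 - ∑ i, X i) k

/-- The derivations `∂_1, …, ∂_d, 0`. -/
def baryD (k : Fin (d+1)) : Derivation ℝ (MvPolynomial (Fin d) ℝ) (MvPolynomial (Fin d) ℝ) :=
  Fin.snoc (α := fun _ => Derivation ℝ (MvPolynomial (Fin d) ℝ) (MvPolynomial (Fin d) ℝ))
    (fun i => pderiv i) 0 k

@[simp] theorem baryX_castSucc (i : Fin d) : baryX i.castSucc = X i := by simp [baryX]

@[simp] theorem baryX_last : baryX (Fin.last d) = 1 - ∑ i, X i := by simp [baryX]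

@[simp] theorem baryD_castSucc (i : Fin d) : baryD i.castSucc = pderiv i := by simp [baryD]

@[simp] theorem baryD_last : baryD (Fin.last d) = 0 := by simp [baryD]

theorem sum_baryX : ∑ k, baryX (d := d) k = 1 := by simp [Fin.sum_univ_castSucc]

theorem eval_baryX (x : Fin d → ℝ) (k : Fin (d+1)) : eval x (baryX k) = xe x k := by
  refine Fin.lastCases ?_ (fun i => ?_) k
  · simp [xe_last]
  · simp [xe_castSucc]

/-- An exponent vector, extended by `0` in the last barycentric coordinate. -/
def baryExp (α : Fin d →₀ ℕ) (k : Fin (d+1)) : ℕ := Fin.snoc (α := fun _ => ℕ) α 0 k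

@[simp] theorem baryExp_castSucc (α : Fin d →₀ ℕ) (i : Fin d) : baryExp α i.castSucc = α i := by
  simp [baryExp]

@[simp] theorem baryExp_last (α : Fin d →₀ ℕ) : baryExp α (Fin.last d) = 0 := by simp [baryExp]

theorem X_mul_pderiv_monomial_eq (α : Fin d →₀ ℕ) (r : ℝ) (i : Fin d) :
    X i * pderiv i (monomial α r) = (α i : ℝ) • monomial α r := by
  rw [X_mul_pderiv_monomial, Nat.cast_smul_eq_nsmul]

theorem baryX_mul_baryD_monomial (α : Fin d →₀ ℕ) (r : ℝ) (k : Fin (d+1)) :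
    baryX k * baryD k (monomial α r) = (baryExp α k : ℝ) • monomial α r := by
  refine Fin.lastCases ?_ (fun i => ?_) k
  · simp
  · rw [baryX_castSucc, baryD_castSucc, baryExp_castSucc, X_mul_pderiv_monomial_eq]

/-- The second order operator attached to the edge `{i, j}` of the simplex. -/
def edgeOp (κ : Fin (d+1) → ℝ) (i j : Fin (d+1)) :
    MvPolynomial (Fin d) ℝ →ₗ[ℝ] MvPolynomial (Fin d) ℝ :=
  -(LinearMap.mulLeft ℝ (baryX i * baryX j) ∘ₗ
      ((baryD i).toLinearMap - (baryD j).toLinearMap) ∘ₗ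
      ((baryD i).toLinearMap - (baryD j).toLinearMap) +
    LinearMap.mulLeft ℝ (C (κ i + 1) * baryX j - C (κ j + 1) * baryX i) ∘ₗ
      ((baryD i).toLinearMap - (baryD j).toLinearMap))

theorem edgeOp_apply (κ : Fin (d+1) → ℝ) (i j : Fin (d+1)) (f : MvPolynomial (Fin d) ℝ) :
    edgeOp κ i j f = -(baryX i * baryX j *
        (baryD i (baryD i f - baryD j f) - baryD j (baryD i f - baryD j f)) +
      (C (κ i + 1) * baryX j - C (κ j + 1) * baryX i) * (baryD i f - baryD j f)) := rfl

/-- The Jacobi operator `-D_κ` on polynomials, as a sum over the edges of the simplex. -/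
def jacobiOp (κ : Fin (d+1) → ℝ) : MvPolynomial (Fin d) ℝ →ₗ[ℝ] MvPolynomial (Fin d) ℝ :=
  (1 / 2 : ℝ) • ∑ i, ∑ j, edgeOp κ i j

theorem sum_sum_edge_expansion {R ι : Type*} [CommRing R] [Fintype ι] (x c u : ι → R)
    (w : ι → ι → R) (hx : ∑ i, x i = 1) :
    ∑ i, ∑ j, (x i * x j * (w i i - w i j - (w j i - w j j)) +
        (c i * x j - c j * x i) * (u i - u j)) =
      2 * (∑ i, x i * w i i - ∑ i, ∑ j, x i * x j * w i j + ∑ i, c i * u i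
        - (∑ j, c j) * ∑ i, x i * u i) := by
  have h : ∀ i j, x i * x j * (w i i - w i j - (w j i - w j j)) +
        (c i * x j - c j * x i) * (u i - u j) =
      (x i * w i i * x j - x i * x j * w i j + (c i * u i * x j - c j * (x i * u i))) +
      (x j * w j j * x i - x j * x i * w j i + (c j * u j * x i - c i * (x j * u j))) := by
    intro i j; ring
  simp only [h, sum_add_distrib (s := univ) (f := fun j => x _ * w _ _ * x j - _ + _)]
  rw [sum_add_distrib, sum_comm (f := fun i j =>
    (x j * w j j * x i - x j * x i * w j i + (c j * u j * x i - c i * (x j * u j))))]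
  simp only [sum_add_distrib, sum_sub_distrib, ← mul_sum, ← sum_mul, hx, mul_one]
  ring

theorem jacobiOp_apply (κ : Fin (d+1) → ℝ) (f : MvPolynomial (Fin d) ℝ) :
    jacobiOp κ f = ∑ i, ∑ j, X i * X j * pderiv i (pderiv j f)
      + C (∑ k, κ k + d + 1) * ∑ i, X i * pderiv i f
      - ∑ i, X i * pderiv i (pderiv i f) - ∑ i, C (κ i.castSucc + 1) * pderiv i f := by
  have h := sum_sum_edge_expansion (baryX (d := d)) (fun i => C (κ i + 1))
    (fun i => baryD i f) (fun i j => baryD i (baryD j f)) sum_baryX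
  simp only [jacobiOp, LinearMap.smul_apply, LinearMap.sum_apply, edgeOp_apply, map_sub,
    sum_neg_distrib]
  rw [h]
  have hc : ∑ k, C (κ k + 1) = (C (∑ k, κ k + d + 1) : MvPolynomial (Fin d) ℝ) := by
    rw [← map_sum, sum_add_distrib]; simp [add_assoc]
  have h2 : ∀ p : MvPolynomial (Fin d) ℝ, (1 / 2 : ℝ) • -(2 * p) = -p := by
    intro p
    rw [two_mul, ← two_smul ℝ p, smul_neg, smul_smul]
    norm_num
  rw [h2, hc]
  simp only [Fin.sum_univ_castSucc (n := d), baryX_castSucc, baryD_castSucc, baryD_last,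
    Derivation.zero_apply, map_zero, mul_zero, add_zero, sum_const_zero]
  ring

/-- The Dirichlet energy summand of the edge `{i, j}`, with respect to the functional `J`. -/
def edgeForm (J : MvPolynomial (Fin d) ℝ →ₗ[ℝ] ℝ) (i j : Fin (d+1))
    (f g : MvPolynomial (Fin d) ℝ) : ℝ :=
  J (baryX i * baryX j * ((baryD i f - baryD j f) * (baryD i g - baryD j g)))

theorem edgeForm_comm_edge (J : MvPolynomial (Fin d) ℝ →ₗ[ℝ] ℝ) (i j : Fin (d+1))
    (f g : MvPolynomial (Fin d) ℝ) : edgeForm J i j f g = edgeForm J j i f g := by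
  unfold edgeForm; congr 1; ring

theorem edgeForm_comm (J : MvPolynomial (Fin d) ℝ →ₗ[ℝ] ℝ) (i j : Fin (d+1))
    (f g : MvPolynomial (Fin d) ℝ) : edgeForm J i j f g = edgeForm J i j g f := by
  unfold edgeForm; congr 1; ring

theorem edgeForm_self (J : MvPolynomial (Fin d) ℝ →ₗ[ℝ] ℝ) (i : Fin (d+1))
    (f g : MvPolynomial (Fin d) ℝ) : edgeForm J i i f g = 0 := by
  simp [edgeForm]

theorem stokes_of_moments {κ : Fin (d+1) → ℝ} {J : MvPolynomial (Fin d) ℝ →ₗ[ℝ] ℝ}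
    (hJ : ∀ α, ∃ M, ∀ k, J (baryX k * monomial α 1) = (κ k + 1 + baryExp α k) * M)
    (i j : Fin (d+1)) (F : MvPolynomial (Fin d) ℝ) :
    J (baryX i * baryX j * (baryD i F - baryD j F) +
      (C (κ i + 1) * baryX j - C (κ j + 1) * baryX i) * F) = 0 := by
  induction F using MvPolynomial.induction_on' with
  | monomial α r =>
    obtain ⟨M, hM⟩ := hJ α
    have e : baryX i * baryX j * (baryD i (monomial α r) - baryD j (monomial α r)) +
        (C (κ i + 1) * baryX j - C (κ j + 1) * baryX i) * monomial α r =
        ((κ i + 1 + baryExp α i) * r) • (baryX j * monomial α 1) -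
        ((κ j + 1 + baryExp α j) * r) • (baryX i * monomial α 1) := by
      have hr : monomial α r = r • monomial α (1 : ℝ) := by rw [smul_monomial, smul_eq_mul, mul_one]
      calc _ = baryX j * (baryX i * baryD i (monomial α r)) -
            baryX i * (baryX j * baryD j (monomial α r)) +
            (C (κ i + 1) * baryX j - C (κ j + 1) * baryX i) * monomial α r := by ring
        _ = _ := by
          rw [baryX_mul_baryD_monomial, baryX_mul_baryD_monomial, hr]
          simp only [smul_eq_C_mul, map_add, map_mul]
          ring
    rw [e, map_sub, map_smul, map_smul, hM, hM, smul_eq_mul, smul_eq_mul]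
    ring
  | add p q hp hq =>
    rw [← add_zero (0 : ℝ)]
    nth_rewrite 1 [← hp]
    rw [← hq, ← map_add]
    congr 1
    simp only [map_add]
    ring

theorem edgeOp_form {κ : Fin (d+1) → ℝ} {J : MvPolynomial (Fin d) ℝ →ₗ[ℝ] ℝ}
    (hJ : ∀ α, ∃ M, ∀ k, J (baryX k * monomial α 1) = (κ k + 1 + baryExp α k) * M)
    (i j : Fin (d+1)) (f g : MvPolynomial (Fin d) ℝ) :
    J (edgeOp κ i j f * g) = edgeForm J i j f g := by
  have h := stokes_of_moments hJ i j (g * (baryD i f - baryD j f))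
  rw [edgeForm, ← sub_eq_zero, ← map_sub, ← neg_eq_zero, ← map_neg, ← h, edgeOp_apply]
  congr 1
  simp only [Derivation.leibniz, smul_eq_mul, map_sub]
  ring

theorem jacobiOp_form {κ : Fin (d+1) → ℝ} {J : MvPolynomial (Fin d) ℝ →ₗ[ℝ] ℝ}
    (hJ : ∀ α, ∃ M, ∀ k, J (baryX k * monomial α 1) = (κ k + 1 + baryExp α k) * M)
    (f g : MvPolynomial (Fin d) ℝ) :
    J (jacobiOp κ f * g) = 1 / 2 * ∑ i, ∑ j, edgeForm J i j f g := by
  simp only [jacobiOp, LinearMap.smul_apply, LinearMap.sum_apply, smul_mul_assoc, sum_mul, map_smul,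
    map_sum, edgeOp_form hJ, smul_eq_mul]

/-- The polynomials of degree less than `n` with monomials from `S`. -/
def degLT (S : Set (Fin d →₀ ℕ)) (n : ℕ) : Submodule ℝ (MvPolynomial (Fin d) ℝ) :=
  restrictSupport ℝ {α ∈ S | α.degree < n}

theorem mem_degLT {S : Set (Fin d →₀ ℕ)} {n : ℕ} {f : MvPolynomial (Fin d) ℝ} :
    f ∈ degLT S n ↔ ∀ α ∈ f.support, α ∈ S ∧ α.degree < n := by
  rw [degLT, mem_restrictSupport_iff]; rfl

theorem degLT_mono (S : Set (Fin d →₀ ℕ)) : Monotone (degLT S) := fun _ _ h _ hf =>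
  mem_degLT.2 fun α hα => ⟨(mem_degLT.1 hf α hα).1, (mem_degLT.1 hf α hα).2.trans_le h⟩

theorem degLT_zero (S : Set (Fin d →₀ ℕ)) : degLT S 0 = ⊥ := by
  refine (Submodule.eq_bot_iff _).2 fun f hf => ?_
  rw [← support_eq_empty, eq_empty_iff_forall_notMem]
  exact fun α hα => absurd (mem_degLT.1 hf α hα).2 (Nat.not_lt_zero _)

theorem monomial_mem_degLT {S : Set (Fin d →₀ ℕ)} {n : ℕ} {α : Fin d →₀ ℕ} (hS : α ∈ S)
    (hα : α.degree < n) (r : ℝ) : monomial α r ∈ degLT S n :=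
  mem_degLT.2 fun β hβ => by
    have := support_monomial_subset hβ
    rw [mem_singleton] at this
    exact this ▸ ⟨hS, hα⟩

theorem pderiv_monomial_mem_degLT {S : Set (Fin d →₀ ℕ)}
    (hS : ∀ α ∈ S, ∀ i, α i ≠ 0 → α - Finsupp.single i 1 ∈ S) {α : Fin d →₀ ℕ} (hα : α ∈ S)
    (i : Fin d) (r : ℝ) : pderiv i (monomial α r) ∈ degLT S α.degree := by
  rw [pderiv_monomial]
  rcases eq_or_ne (α i) 0 with h | h
  · simp [h]
  · refine monomial_mem_degLT (hS α hα i h) ?_ _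
    have h1 : α - Finsupp.single i 1 + Finsupp.single i 1 = α :=
      tsub_add_cancel_of_le (by simpa using Nat.one_le_iff_ne_zero.2 h)
    have h2 := congrArg Finsupp.degree h1
    rw [map_add, Finsupp.degree_single] at h2
    omega

theorem jacobiOp_monomial (κ : Fin (d+1) → ℝ) (α : Fin d →₀ ℕ) (r : ℝ) :
    jacobiOp κ (monomial α r) =
      ((α.degree : ℝ) * (α.degree + ∑ k, κ k + d)) • monomial α r
      - ∑ i, (α i + κ i.castSucc) • pderiv i (monomial α r) := by
  have hself : ∀ i, X i * pderiv i (pderiv i (monomial α r)) =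
      ((α i : ℝ) - 1) • pderiv i (monomial α r) := by
    intro i
    have h := congrArg (pderiv i) (X_mul_pderiv_monomial_eq α r i)
    rw [pderiv_mul, pderiv_X_self, one_mul, Derivation.map_smul] at h
    rw [sub_smul, one_smul, ← h]
    ring
  have hmix : ∀ i j, X i * X j * pderiv i (pderiv j (monomial α r)) =
      ((α i : ℝ) * α j) • monomial α r - if i = j then (α i : ℝ) • monomial α r else 0 := by
    intro i j
    have h : X i * pderiv i (X j * pderiv j (monomial α r)) =
        (α j : ℝ) • (α i : ℝ) • monomial α r := by
      rw [X_mul_pderiv_monomial_eq, Derivation.map_smul, mul_smul_comm, X_mul_pderiv_monomial_eq]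
    rw [pderiv_mul] at h
    rcases eq_or_ne i j with rfl | hij
    · rw [pderiv_X_self, one_mul, mul_add, X_mul_pderiv_monomial_eq] at h
      rw [if_pos rfl, mul_smul, ← h]
      ring
    · rw [pderiv_X_of_ne hij.symm, zero_mul, zero_add] at h
      rw [if_neg hij, sub_zero, mul_comm (α i : ℝ), mul_smul, ← h]
      ring
  have hdeg : (α.degree : ℝ) = ∑ i, (α i : ℝ) := by
    rw [Finsupp.degree_eq_sum]; push_cast; rfl
  rw [jacobiOp_apply]
  simp only [hself, hmix, X_mul_pderiv_monomial_eq, sum_sub_distrib, sum_ite_eq, mem_univ, if_true,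
    ← sum_smul, ← mul_sum, ← sum_mul, ← hdeg, ← smul_eq_C_mul, add_smul, sub_smul,
    sum_add_distrib, one_smul]
  module

theorem jacobiOp_sub_mem_degLT {S : Set (Fin d →₀ ℕ)}
    (hS : ∀ α ∈ S, ∀ i, α i ≠ 0 → α - Finsupp.single i 1 ∈ S) (κ : Fin (d+1) → ℝ) (n : ℕ)
    (f : MvPolynomial (Fin d) ℝ) (hf : f ∈ degLT S (n + 1)) :
    jacobiOp κ f - ((n : ℝ) * (n + ∑ k, κ k + d)) • f ∈ degLT S n := by
  have hf' := mem_degLT.1 hf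
  rw [f.as_sum, map_sum, smul_sum, ← sum_sub_distrib]
  refine sum_mem fun α hα => ?_
  obtain ⟨hαS, hαn⟩ := hf' α hα
  rw [jacobiOp_monomial, sub_right_comm, ← sub_smul]
  refine sub_mem ?_ (sum_mem fun i _ => Submodule.smul_mem _ _
    (degLT_mono S (Nat.lt_succ_iff.1 hαn) (pderiv_monomial_mem_degLT hS hαS i _)))
  rcases (Nat.lt_succ_iff.1 hαn).eq_or_lt with h | h
  · rw [h, sub_self, zero_smul]
    exact zero_mem _
  · exact Submodule.smul_mem _ _ (monomial_mem_degLT hαS h _)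

theorem strictMono_eigenvalue {κ : Fin (d+1) → ℝ} (hκ : ∀ i, -1 < κ i) :
    StrictMono fun n : ℕ => (n : ℝ) * (n + ∑ k, κ k + d) := by
  have h : 0 < ∑ k, (κ k + 1) := sum_pos (fun k _ => by linarith [hκ k]) univ_nonempty
  rw [sum_add_distrib] at h
  simp only [sum_const, card_univ, Fintype.card_fin, nsmul_eq_mul, mul_one] at h
  push_cast at h
  refine strictMono_nat_of_lt_succ fun n => ?_
  push_cast
  have : (0 : ℝ) ≤ n := n.cast_nonneg
  nlinarith

theorem sum_sum_eq_of_symm {ι : Type*} [Fintype ι] [DecidableEq ι] (a : ι → ι → ℝ)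
    (hs : ∀ i j, a i j = a j i) (l : ι) (hl : a l l = 0) :
    ∑ i, ∑ j, a i j = 2 * ∑ j, a l j + ∑ i ∈ univ.erase l, ∑ j ∈ univ.erase l, a i j := by
  have h : ∀ i, ∑ j, a i j = a i l + ∑ j ∈ univ.erase l, a i j := fun i =>
    (add_sum_erase univ _ (mem_univ l)).symm
  rw [← add_sum_erase univ _ (mem_univ l), sum_congr rfl fun i _ => h i, sum_add_distrib,
    sum_congr rfl fun i _ => hs i l, two_mul, h l, hl]
  ring

end BarycentricPolynomials

section JacobiFunctional

open MvPolynomial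

variable {d : ℕ}

theorem integrableOn_eval_mul_Wk {κ : Fin (d+1) → ℝ} (hκ : ∀ i, -1 < κ i)
    (p : MvPolynomial (Fin d) ℝ) : IntegrableOn (fun x => eval x p * Wk κ x) (Splx d) :=
  (integrableOn_Wk hκ).continuousOn_mul (MvPolynomial.continuous_eval p).continuousOn
    (isCompact_Splx d)

/-- Normalized integration of polynomials against the Jacobi weight. -/
def jacobiFunctional (κ : Fin (d+1) → ℝ) (hκ : ∀ i, -1 < κ i) :
    MvPolynomial (Fin d) ℝ →ₗ[ℝ] ℝ where
  toFun p := bk κ * ∫ x in Splx d, eval x p * Wk κ x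
  map_add' p q := by
    simp only [map_add, add_mul]
    rw [integral_add (integrableOn_eval_mul_Wk hκ p) (integrableOn_eval_mul_Wk hκ q), mul_add]
  map_smul' r p := by
    simp only [smul_eval, mul_assoc, RingHom.id_apply, smul_eq_mul]
    rw [integral_const_mul]
    ring

theorem jacobiFunctional_apply (κ : Fin (d+1) → ℝ) (hκ : ∀ i, -1 < κ i)
    (p : MvPolynomial (Fin d) ℝ) :
    jacobiFunctional κ hκ p = bk κ * ∫ x in Splx d, eval x p * Wk κ x := rfl

theorem bk_pos {κ : Fin (d+1) → ℝ} (hκ : ∀ i, -1 < κ i) : 0 < bk κ := by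
  have h : 0 < ∑ k, (κ k + 1) := sum_pos (fun k _ => by linarith [hκ k]) univ_nonempty
  rw [sum_add_distrib] at h
  simp only [sum_const, card_univ, Fintype.card_fin, nsmul_eq_mul, mul_one] at h
  push_cast at h
  exact div_pos (Real.Gamma_pos_of_pos (by linarith))
    (prod_pos fun i _ => Real.Gamma_pos_of_pos (by linarith [hκ i]))

theorem Wk_nonneg (κ : Fin (d+1) → ℝ) {x : Fin d → ℝ} (hx : x ∈ Splx d) : 0 ≤ Wk κ x := by
  rw [Wk_eq_prod]
  exact prod_nonneg fun k _ => Real.rpow_nonneg (mem_Splx_iff.1 hx k) _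

theorem jacobiFunctional_nonneg (κ : Fin (d+1) → ℝ) (hκ : ∀ i, -1 < κ i)
    {p : MvPolynomial (Fin d) ℝ} (hp : ∀ x ∈ Splx d, 0 ≤ eval x p) :
    0 ≤ jacobiFunctional κ hκ p :=
  mul_nonneg (bk_pos hκ).le <| setIntegral_nonneg (isClosed_Splx d).measurableSet fun x hx =>
    mul_nonneg (hp x hx) (Wk_nonneg κ hx)

theorem rpow_mul_pow_of_nonneg {x a : ℝ} (hx : 0 ≤ x) (ha : -1 < a) (n : ℕ) :
    x ^ n * x ^ a = x ^ (a + n) := by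
  rcases eq_or_ne n 0 with rfl | hn
  · simp
  · have h1 : (1 : ℝ) ≤ n := by exact_mod_cast Nat.one_le_iff_ne_zero.2 hn
    rw [Real.rpow_add' hx (by linarith), Real.rpow_natCast, mul_comm]

theorem eval_monomial_mul_Wk {κ : Fin (d+1) → ℝ} (hκ : ∀ i, -1 < κ i) (α : Fin d →₀ ℕ)
    {x : Fin d → ℝ} (hx : x ∈ Splx d) :
    eval x (monomial α 1) * Wk κ x = Wk (fun k => κ k + baryExp α k) x := by
  rw [eval_monomial, one_mul, Finsupp.prod_fintype _ _ fun i => pow_zero _]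
  simp only [Wk, baryExp_castSucc, baryExp_last, Nat.cast_zero, add_zero]
  rw [← mul_assoc, ← prod_mul_distrib]
  simp only [fun i => rpow_mul_pow_of_nonneg (hx.1 i) (hκ i.castSucc) (α i)]

theorem jacobiFunctional_moments (κ : Fin (d+1) → ℝ) (hκ : ∀ i, -1 < κ i) (α : Fin d →₀ ℕ) :
    ∃ M, ∀ k, jacobiFunctional κ hκ (baryX k * monomial α 1) = (κ k + 1 + baryExp α k) * M := by
  set κ' : Fin (d+1) → ℝ := fun k => κ k + baryExp α k with hκ'_def
  have hκ' : ∀ k, -1 < κ' k := fun k =>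
    (hκ k).trans_le (le_add_of_nonneg_right (Nat.cast_nonneg _))
  have hmom : ∀ k, jacobiFunctional κ hκ (baryX k * monomial α 1) =
      bk κ * ∫ x in Splx d, xe x k * Wk κ' x := by
    intro k
    rw [jacobiFunctional_apply]
    congr 1
    refine setIntegral_congr_fun (isClosed_Splx d).measurableSet fun x hx => ?_
    simp only [map_mul, eval_baryX, mul_assoc, eval_monomial_mul_Wk hκ α hx, hκ'_def]
  have hint : ∀ k, IntegrableOn (fun x => xe x k * Wk κ' x) (Splx d) := by
    intro k
    simpa only [eval_baryX] using integrableOn_eval_mul_Wk hκ' (baryX k)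
  have hne : κ' (Fin.last d) + 1 ≠ 0 := by linarith [hκ' (Fin.last d)]
  refine ⟨bk κ * (∫ x in Splx d, xe x (Fin.last d) * Wk κ' x) / (κ' (Fin.last d) + 1),
    fun k => ?_⟩
  rw [hmom]
  have hk : κ k + 1 + baryExp α k = κ' k + 1 := by simp only [hκ'_def]; ring
  rw [hk]
  refine Fin.lastCases (by field_simp) (fun i => ?_) k
  have h := integral_Wk_stokes hκ' i
  simp only [sub_mul, mul_assoc] at h
  rw [integral_sub ((hint _).const_mul _) ((hint _).const_mul _), integral_const_mul,
    integral_const_mul] at h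
  field_simp
  linear_combination (-bk κ) * h

theorem hasFDerivAt_eval (p : MvPolynomial (Fin d) ℝ) (x : Fin d → ℝ) :
    HasFDerivAt (fun x => eval x p)
      (∑ i, eval x (pderiv i p) • (ContinuousLinearMap.proj i : (Fin d → ℝ) →L[ℝ] ℝ)) x := by
  induction p using MvPolynomial.induction_on with
  | C a => simpa using hasFDerivAt_const a x
  | add p q hp hq =>
    simp only [map_add, add_smul, sum_add_distrib]
    exact hp.add hq
  | mul_X p j hp =>
    simp only [map_mul, eval_X]
    refine (hp.mul (hasFDerivAt_apply j x)).congr_fderiv ?_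
    simp only [pderiv_mul, map_add, map_mul, eval_X, pderiv_X, add_smul, sum_add_distrib,
      smul_sum, smul_smul, Pi.single_apply, apply_ite (eval x), map_zero, mul_ite, mul_one,
      mul_zero, ite_smul, zero_smul, sum_ite_eq, mem_univ, if_true]
    rw [add_comm]
    simp only [mul_comm (x j)]

theorem pd_eval (i : Fin d) (p : MvPolynomial (Fin d) ℝ) :
    pd i (fun x => eval x p) = fun x => eval x (pderiv i p) := by
  funext x
  simp [pd, (hasFDerivAt_eval p x).fderiv, Pi.single_apply]

theorem nrm2_sq (κ : Fin (d+1) → ℝ) (hκ : ∀ i, -1 < κ i) {F : (Fin d → ℝ) → ℝ}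
    {p : MvPolynomial (Fin d) ℝ} (hF : ∀ x ∈ Splx d, F x * F x = eval x p) :
    nrm2 κ F ^ 2 = jacobiFunctional κ hκ p := by
  have h : ipk κ F F = jacobiFunctional κ hκ p := by
    rw [ipk, jacobiFunctional_apply]
    congr 1
    refine setIntegral_congr_fun (isClosed_Splx d).measurableSet fun x hx => ?_
    simp only [hF x hx]
  rw [nrm2, h, Real.sq_sqrt]
  exact jacobiFunctional_nonneg κ hκ fun x hx => hF x hx ▸ mul_self_nonneg _

theorem edgeForm_jacobiFunctional_nonneg (κ : Fin (d+1) → ℝ) (hκ : ∀ i, -1 < κ i)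
    (i j : Fin (d+1)) (f : MvPolynomial (Fin d) ℝ) :
    0 ≤ edgeForm (jacobiFunctional κ hκ) i j f f := by
  refine jacobiFunctional_nonneg κ hκ fun x hx => ?_
  simp only [map_mul, eval_baryX]
  exact mul_nonneg (mul_nonneg (mem_Splx_iff.1 hx i) (mem_Splx_iff.1 hx j)) (mul_self_nonneg _)

theorem nrm2_sqrt_sq_eq_edgeForm (κ : Fin (d+1) → ℝ) (hκ : ∀ i, -1 < κ i) (i j : Fin (d+1))
    (f : MvPolynomial (Fin d) ℝ) :
    nrm2 κ (fun x => Real.sqrt (xe x i * xe x j) * eval x (baryD i f - baryD j f)) ^ 2 =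
      edgeForm (jacobiFunctional κ hκ) i j f f := by
  refine nrm2_sq κ hκ fun x hx => ?_
  rw [mul_mul_mul_comm,
    Real.mul_self_sqrt (mul_nonneg (mem_Splx_iff.1 hx i) (mem_Splx_iff.1 hx j))]
  simp only [map_mul, eval_baryX]

theorem lform_eq_sum_edgeForm (κ : Fin (d+1) → ℝ) (hκ : ∀ i, -1 < κ i) (l : Fin d)
    (f : MvPolynomial (Fin d) ℝ) :
    lform κ l (fun x => eval x f) =
      ∑ j, edgeForm (jacobiFunctional κ hκ) l.castSucc j f f := by
  rw [Fin.sum_univ_castSucc, ← add_sum_erase univ _ (mem_univ l), edgeForm_self, zero_add, add_comm,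
    lform, filter_ne']
  simp only [← nrm2_sqrt_sq_eq_edgeForm, pdd, pd_eval, xe_castSucc, xe_last, baryD_castSucc,
    baryD_last, Derivation.zero_apply, sub_zero, map_sub]

/-- The inner product `⟨f, g⟩_κ` on polynomials. -/
def jacobiInner (κ : Fin (d+1) → ℝ) (hκ : ∀ i, -1 < κ i) :
    LinearMap.BilinForm ℝ (MvPolynomial (Fin d) ℝ) :=
  (LinearMap.mul ℝ (MvPolynomial (Fin d) ℝ)).compr₂ (jacobiFunctional κ hκ)

theorem jacobiInner_apply (κ : Fin (d+1) → ℝ) (hκ : ∀ i, -1 < κ i)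
    (f g : MvPolynomial (Fin d) ℝ) : jacobiInner κ hκ f g = jacobiFunctional κ hκ (f * g) := rfl

theorem jacobiInner_comm (κ : Fin (d+1) → ℝ) (hκ : ∀ i, -1 < κ i)
    (f g : MvPolynomial (Fin d) ℝ) : jacobiInner κ hκ f g = jacobiInner κ hκ g f := by
  rw [jacobiInner_apply, jacobiInner_apply, mul_comm]

theorem jacobiInner_self_nonneg (κ : Fin (d+1) → ℝ) (hκ : ∀ i, -1 < κ i)
    (f : MvPolynomial (Fin d) ℝ) : 0 ≤ jacobiInner κ hκ f f :=
  jacobiFunctional_nonneg κ hκ fun x _ => by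
    rw [LinearMap.mul_apply', map_mul]; exact mul_self_nonneg _

theorem nrm2_eval_sq (κ : Fin (d+1) → ℝ) (hκ : ∀ i, -1 < κ i) (f : MvPolynomial (Fin d) ℝ) :
    nrm2 κ (fun x => eval x f) ^ 2 = jacobiInner κ hκ f f :=
  nrm2_sq κ hκ fun x _ => by rw [LinearMap.mul_apply', map_mul]

theorem jacobiInner_jacobiOp_left (κ : Fin (d+1) → ℝ) (hκ : ∀ i, -1 < κ i)
    (f g : MvPolynomial (Fin d) ℝ) :
    jacobiInner κ hκ (jacobiOp κ f) g = jacobiInner κ hκ f (jacobiOp κ g) := by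
  rw [jacobiInner_comm κ hκ f, jacobiInner_apply, jacobiInner_apply,
    jacobiOp_form (jacobiFunctional_moments κ hκ), jacobiOp_form (jacobiFunctional_moments κ hκ)]
  simp only [edgeForm_comm _ _ _ f g]

theorem jacobiInner_jacobiOp_self (κ : Fin (d+1) → ℝ) (hκ : ∀ i, -1 < κ i) (l : Fin d)
    (f : MvPolynomial (Fin d) ℝ) :
    jacobiInner κ hκ (jacobiOp κ f) f = lform κ l (fun x => eval x f) +
      1 / 2 * ∑ i ∈ univ.erase l.castSucc, ∑ j ∈ univ.erase l.castSucc,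
        edgeForm (jacobiFunctional κ hκ) i j f f := by
  rw [jacobiInner_apply, jacobiOp_form (jacobiFunctional_moments κ hκ),
    lform_eq_sum_edgeForm κ hκ, sum_sum_eq_of_symm _
      (fun i j => edgeForm_comm_edge _ i j f f) l.castSucc (edgeForm_self _ _ _ _)]
  ring

theorem lform_le (κ : Fin (d+1) → ℝ) (hκ : ∀ i, -1 < κ i) (l : Fin d) {n : ℕ}
    {f : MvPolynomial (Fin d) ℝ} (hf : f.totalDegree ≤ n) :
    lform κ l (fun x => eval x f) ≤
      (n : ℝ) * (n + ∑ k, κ k + d) * nrm2 κ (fun x => eval x f) ^ 2 := by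
  have hmem : f ∈ degLT Set.univ (n + 1) := mem_degLT.2 fun α hα =>
    ⟨trivial, Nat.lt_succ_of_le ((le_totalDegree hα).trans hf)⟩
  have h := rayleigh_le_of_triangular (degLT_mono Set.univ) (degLT_zero Set.univ)
    (strictMono_eigenvalue hκ) (jacobiOp_sub_mem_degLT (fun _ _ _ _ => Set.mem_univ _) κ)
    (jacobiInner_jacobiOp_left κ hκ) (jacobiInner_comm κ hκ) (jacobiInner_self_nonneg κ hκ) n f hmem
  rw [jacobiInner_jacobiOp_self κ hκ l, ← nrm2_eval_sq] at h
  have : 0 ≤ ∑ i ∈ univ.erase l.castSucc, ∑ j ∈ univ.erase l.castSucc,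
        edgeForm (jacobiFunctional κ hκ) i j f f :=
    sum_nonneg fun i _ => sum_nonneg fun j _ => edgeForm_jacobiFunctional_nonneg κ hκ i j f
  linarith

theorem pderiv_eq_zero_of_mem_degLT_single {l i : Fin d} (h : i ≠ l) {n : ℕ}
    {f : MvPolynomial (Fin d) ℝ} (hf : f ∈ degLT (Set.range (Finsupp.single l)) n) :
    pderiv i f = 0 := by
  rw [f.as_sum, map_sum]
  refine sum_eq_zero fun α hα => ?_
  obtain ⟨⟨k, rfl⟩, -⟩ := mem_degLT.1 hf α hα
  simp [pderiv_monomial, Finsupp.single_eq_of_ne h]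

theorem exists_lform_eq (κ : Fin (d+1) → ℝ) (hκ : ∀ i, -1 < κ i) (l : Fin d) (n : ℕ) :
    ∃ f : MvPolynomial (Fin d) ℝ, f ≠ 0 ∧ f.totalDegree = n ∧
      lform κ l (fun x => eval x f) =
        (n : ℝ) * (n + ∑ k, κ k + d) * nrm2 κ (fun x => eval x f) ^ 2 := by
  set S : Set (Fin d →₀ ℕ) := Set.range (Finsupp.single l) with hS_def
  have hS : ∀ α ∈ S, ∀ i, α i ≠ 0 → α - Finsupp.single i 1 ∈ S := by
    rintro _ ⟨k, rfl⟩ i hi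
    obtain rfl : i = l := by
      by_contra h
      exact hi (Finsupp.single_eq_of_ne h)
    exact ⟨k - 1, Finsupp.single_tsub⟩
  have hX : monomial (Finsupp.single l n) (1 : ℝ) ∈ degLT S (n + 1) :=
    monomial_mem_degLT (Set.mem_range_self n) (by simp) 1
  obtain ⟨h, hh, heig⟩ := exists_eigenvector_of_triangular (degLT_mono S) (degLT_zero S)
    (strictMono_eigenvalue hκ) (jacobiOp_sub_mem_degLT hS κ) hX
  set f := monomial (Finsupp.single l n) (1 : ℝ) - h with hf_def
  have hf : f ∈ degLT S (n + 1) := sub_mem hX (degLT_mono S n.le_succ hh)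
  have hcoeff : Finsupp.single l n ∈ f.support := by
    have h0 : coeff (Finsupp.single l n) h = 0 := by
      by_contra hne
      have := (mem_degLT.1 hh _ (mem_support_iff.2 hne)).2
      simp at this
    rw [mem_support_iff, hf_def, coeff_sub, h0]
    simp
  refine ⟨f, support_nonempty.1 ⟨_, hcoeff⟩, le_antisymm ?_ ?_, ?_⟩
  · exact Finset.sup_le fun α hα => Nat.lt_succ_iff.1 (mem_degLT.1 hf α hα).2
  · have := le_totalDegree hcoeff
    simpa using this
  · have hD : ∀ i ∈ univ.erase l.castSucc, baryD i f = 0 := by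
      intro i
      refine Fin.lastCases (by simp) (fun i hi => ?_) i
      rw [baryD_castSucc]
      exact pderiv_eq_zero_of_mem_degLT_single (by simpa using hi) hf
    have h1 := jacobiInner_jacobiOp_self κ hκ l f
    rw [heig, map_smul, LinearMap.smul_apply, smul_eq_mul, ← nrm2_eval_sq,
      sum_eq_zero fun i hi => sum_eq_zero fun j hj => ?_, mul_zero, add_zero] at h1
    · exact h1.symm
    · simp [edgeForm, hD i hi, hD j hj]

end JacobiFunctional

/-- the inequality \eqref{eq:B-ineq0b}, and its sharpness. -/
theorem stmt6 (d : ℕ) (hd : 2 ≤ d) (κ : Fin (d+1) → ℝ) (hκ : ∀ i, -1 < κ i) (n : ℕ)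
    (l : Fin d) :
    (∀ f : MvPolynomial (Fin d) ℝ, f.totalDegree ≤ n →
      lform κ l (fun x => MvPolynomial.eval x f) ≤
        (n : ℝ) * ((n : ℝ) + (∑ k, κ k) + (d : ℝ)) *
          nrm2 κ (fun x => MvPolynomial.eval x f) ^ 2) ∧
    (∃ f : MvPolynomial (Fin d) ℝ, f ≠ 0 ∧ f.totalDegree = n ∧
      lform κ l (fun x => MvPolynomial.eval x f) =
        (n : ℝ) * ((n : ℝ) + (∑ k, κ k) + (d : ℝ)) *
          nrm2 κ (fun x => MvPolynomial.eval x f) ^ 2) := by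
  exact ⟨fun f hf => lform_le κ hκ l hf, exists_lform_eq κ hκ l n⟩
end
end

section
/- For d ≥ 2 and κ_i ≥ 0 (i = 1,…,d+1), the spectral operator D_κ admits the decomposition: for every twice continuously differentiable f on △^d and every x in the interior of △^d, D_κ f(x) = (1/W_κ(x)) [ |x|^{−d} ⟨x,∇⟩( |x|^{d−1} (1−|x|) W_κ(x) ⟨x,∇⟩ f(x) ) + |x|^{−1} Σ_{1≤i<j≤d} ∂_{i,j}( x_i x_j W_κ(x) ∂_{i,j} f(x) ) ], where ⟨x,∇⟩ = Σ_{i=1}^d x_i ∂_i. -/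
open MeasureTheory Finset

noncomputable section

theorem fderiv_apply_eq_sum_pd {d : ℕ} (g : (Fin d → ℝ) → ℝ) (x v : Fin d → ℝ) :
    fderiv ℝ g x v = ∑ i, v i * pd i g x := by
  conv_lhs => rw [pi_eq_sum_univ' v]
  simp only [map_sum, map_smul, smul_eq_mul, pd]

theorem xgrad_eq_fderiv {d : ℕ} (g : (Fin d → ℝ) → ℝ) (x : Fin d → ℝ) :
    xgrad g x = fderiv ℝ g x x :=
  (fderiv_apply_eq_sum_pd g x x).symm

theorem pdd_eq_fderiv {d : ℕ} (i j : Fin d) (g : (Fin d → ℝ) → ℝ) (x : Fin d → ℝ) :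
    pdd i j g x = fderiv ℝ g x (Pi.single i 1 - Pi.single j 1) := by
  simp [pdd, pd]

theorem pos_and_sum_lt_one_of_mem_interior_Splx {d : ℕ} (hd : 0 < d) {x : Fin d → ℝ}
    (hx : x ∈ interior (Splx d)) : (∀ i, 0 < x i) ∧ ∑ i, x i < 1 := by
  have key : ∀ i : Fin d, ∃ ε > 0, ∀ t : ℝ, |t| < ε → x + t • Pi.single i 1 ∈ Splx d := by
    intro i
    have hc : ContinuousAt (fun t : ℝ => x + t • (Pi.single i 1 : Fin d → ℝ)) 0 := by fun_prop
    have hev := hc.preimage_mem_nhds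
      (show Splx d ∈ nhds (x + (0 : ℝ) • (Pi.single i 1 : Fin d → ℝ)) by
        simpa using mem_interior_iff_mem_nhds.1 hx)
    obtain ⟨ε, hε, h⟩ := Metric.mem_nhds_iff.1 hev
    exact ⟨ε, hε, fun t ht => h (by simpa using ht)⟩
  refine ⟨fun i => ?_, ?_⟩
  · obtain ⟨ε, hε, h⟩ := key i
    have := (h (-(ε / 2)) (by rw [abs_neg, abs_of_pos] <;> linarith)).1 i
    simp at this
    linarith
  · obtain ⟨ε, hε, h⟩ := key ⟨0, hd⟩
    have := (h (ε / 2) (by rw [abs_of_pos] <;> linarith)).2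
    simp [Finset.sum_add_distrib, ← Finset.mul_sum] at this
    linarith

theorem hasFDerivAt_sum_coord {d : ℕ} (x : Fin d → ℝ) :
    HasFDerivAt (fun y : Fin d → ℝ => ∑ i, y i)
      (∑ i, ContinuousLinearMap.proj (R := ℝ) (φ := fun _ : Fin d => ℝ) i) x :=
  HasFDerivAt.fun_sum fun i _ => hasFDerivAt_apply i x

theorem hasFDerivAt_Wk {d : ℕ} (κ : Fin (d + 1) → ℝ) {x : Fin d → ℝ}
    (hx : ∀ i, 0 < x i) (hs : ∑ i, x i < 1) :
    HasFDerivAt (Wk κ)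
      (Wk κ x • ((∑ i : Fin d, κ i.castSucc • (x i)⁻¹ •
          ContinuousLinearMap.proj (R := ℝ) (φ := fun _ : Fin d => ℝ) i)
        + κ (Fin.last d) • (1 - ∑ i, x i)⁻¹ •
          -(∑ i, ContinuousLinearMap.proj (R := ℝ) (φ := fun _ : Fin d => ℝ) i))) x := by
  have hexp : ∀ y : Fin d → ℝ, (∀ i, 0 < y i) → ∑ i, y i < 1 →
      Wk κ y = Real.exp ((∑ i : Fin d, κ i.castSucc * Real.log (y i))
        + κ (Fin.last d) * Real.log (1 - ∑ i, y i)) := by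
    intro y hy hys
    rw [Real.exp_add, Real.exp_sum, Wk, Real.rpow_def_of_pos (by linarith), mul_comm (Real.log _)]
    congr 1
    exact Finset.prod_congr rfl fun i _ => by rw [Real.rpow_def_of_pos (hy i), mul_comm]
  have hev : Wk κ =ᶠ[nhds x] fun y => Real.exp ((∑ i : Fin d, κ i.castSucc * Real.log (y i))
        + κ (Fin.last d) * Real.log (1 - ∑ i, y i)) := by
    have h1 : ∀ᶠ y in nhds x, ∀ i, 0 < y i :=
      Filter.eventually_all.2 fun i =>
        (continuous_apply i).continuousAt.eventually (lt_mem_nhds (hx i))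
    have h2 : ∀ᶠ y in nhds x, ∑ i, y i < 1 :=
      (hasFDerivAt_sum_coord x).continuousAt.eventually (gt_mem_nhds hs)
    filter_upwards [h1, h2] with y hy hys using hexp y hy hys
  refine HasFDerivAt.congr_of_eventuallyEq ?_ hev
  rw [hexp x hx hs]
  refine HasFDerivAt.exp (HasFDerivAt.add (HasFDerivAt.fun_sum fun i _ => ?_) ?_)
  · exact ((hasFDerivAt_apply i x).log (hx i).ne').const_mul _
  · exact (((hasFDerivAt_sum_coord x).const_sub 1).log (by linarith)).const_mul _

theorem fderiv_Wk_apply {d : ℕ} (κ : Fin (d + 1) → ℝ) {x : Fin d → ℝ}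
    (hx : ∀ i, 0 < x i) (hs : ∑ i, x i < 1) (v : Fin d → ℝ) :
    fderiv ℝ (Wk κ) x v = Wk κ x * ((∑ i : Fin d, κ i.castSucc * ((x i)⁻¹ * v i))
      - κ (Fin.last d) * ((1 - ∑ i, x i)⁻¹ * ∑ i, v i)) := by
  rw [(hasFDerivAt_Wk κ hx hs).fderiv]
  simp [sub_eq_add_neg]
  ring

theorem differentiableAt_pd {d : ℕ} {f : (Fin d → ℝ) → ℝ} {x : Fin d → ℝ}
    (hf : ContDiffAt ℝ 2 f x) (i : Fin d) : DifferentiableAt ℝ (pd i f) x :=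
  ((hf.fderiv_right (m := 1) (by norm_num)).differentiableAt (by norm_num)).clm_apply
    (differentiableAt_const _)

theorem pd_pd_comm {d : ℕ} {f : (Fin d → ℝ) → ℝ} {x : Fin d → ℝ}
    (hf : ContDiffAt ℝ 2 f x) (i j : Fin d) : pd i (pd j f) x = pd j (pd i f) x := by
  have hd : DifferentiableAt ℝ (fderiv ℝ f) x :=
    (hf.fderiv_right (m := 1) (by norm_num)).differentiableAt (by norm_num)
  have h : ∀ k l : Fin d,
      pd k (pd l f) x = fderiv ℝ (fderiv ℝ f) x (Pi.single k 1) (Pi.single l 1) := by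
    intro k l
    change fderiv ℝ (fun y => fderiv ℝ f y (Pi.single l 1)) x (Pi.single k 1) = _
    rw [fderiv_clm_apply hd (differentiableAt_const _)]
    simp
  rw [h, h]
  exact (hf.isSymmSndFDerivAt (by simp)).eq _ _

theorem two_mul_sum_sum_lt {d : ℕ} (F : Fin d → Fin d → ℝ) (hF : ∀ i j, F i j = F j i) :
    2 * ∑ i, ∑ j ∈ Finset.univ.filter (fun j => i < j), F i j
      = (∑ i, ∑ j, F i j) - ∑ i, F i i := by
  have hsplit : ∀ i j, F i j = (if i < j then F i j else 0) + (if j < i then F j i else 0)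
      + (if i = j then F i i else 0) := by
    intro i j
    rcases lt_trichotomy i j with h | h | h
    · simp [h, h.ne, h.not_gt]
    · simp [h]
    · simp [h, h.ne', h.not_gt, hF i j]
  have hsum : ∑ i, ∑ j, F i j = (∑ i, ∑ j, if i < j then F i j else 0)
      + (∑ i, ∑ j, if j < i then F j i else 0) + ∑ i, F i i := by
    conv_lhs => enter [2, i, 2, j]; rw [hsplit i j]
    simp [Finset.sum_add_distrib]
  rw [Finset.sum_comm (f := fun i j => if j < i then F j i else 0)] at hsum
  simp only [Finset.sum_filter]
  linarith

theorem xgrad_radial_part {d : ℕ} (κ : Fin (d + 1) → ℝ) {f : (Fin d → ℝ) → ℝ}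
    {x : Fin d → ℝ} (hf : ContDiffAt ℝ 2 f x) (hd : 0 < d) (hx : ∀ i, 0 < x i)
    (hs : ∑ i, x i < 1) :
    xgrad (fun y => (∑ k, y k) ^ (d - 1) * (1 - ∑ k, y k) * Wk κ y * xgrad f y) x
      = (∑ k, x k) ^ (d - 1) * Wk κ x *
        ((1 - ∑ k, x k) * (∑ i, ∑ j, x i * x j * pd i (pd j f) x)
          + (((∑ i : Fin d, κ i.castSucc) + d) * (1 - ∑ k, x k)
            - (κ (Fin.last d) + 1) * ∑ k, x k) * xgrad f x) := by
  have hS := hasFDerivAt_sum_coord x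
  have hW := (hasFDerivAt_Wk κ hx hs).differentiableAt.hasFDerivAt
  have hX : HasFDerivAt (xgrad f) _ x :=
    HasFDerivAt.fun_sum fun i _ =>
      (hasFDerivAt_apply i x).mul (differentiableAt_pd hf i).hasFDerivAt
  have hX' : fderiv ℝ (xgrad f) x x = (∑ i, ∑ j, x i * x j * pd i (pd j f) x) + xgrad f x := by
    rw [hX.fderiv]
    simp only [_root_.sum_apply, add_apply,
      smul_apply, ContinuousLinearMap.proj_apply, smul_eq_mul,
      fderiv_apply_eq_sum_pd, Finset.sum_add_distrib, xgrad, Finset.mul_sum]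
    congr 1
    · rw [Finset.sum_comm]
      exact Finset.sum_congr rfl fun i _ => Finset.sum_congr rfl fun j _ => by ring
    · exact Finset.sum_congr rfl fun i _ => by ring
  have hWx : fderiv ℝ (Wk κ) x x = Wk κ x * ((∑ i : Fin d, κ i.castSucc)
      - κ (Fin.last d) * ((1 - ∑ i, x i)⁻¹ * ∑ i, x i)) := by
    rw [fderiv_Wk_apply κ hx hs]
    congr 3
    funext i
    rw [inv_mul_cancel₀ (hx i).ne', mul_one]
  rw [xgrad_eq_fderiv, HasFDerivAt.fderiv ((((hS.pow (d - 1)).fun_mul (hS.const_sub 1)).fun_mul hW).fun_mul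
    hX.differentiableAt.hasFDerivAt)]
  have hSx : (∑ i, ContinuousLinearMap.proj (R := ℝ) (φ := fun _ : Fin d => ℝ) i) x
      = ∑ i, x i := by simp [_root_.sum_apply]
  simp only [add_apply, smul_apply,
    neg_apply, smul_eq_mul, nsmul_eq_mul, hSx, hX', hWx]
  have h1 : 1 - ∑ i, x i ≠ 0 := by linarith
  obtain ⟨n, rfl⟩ : ∃ n, d = n + 1 := ⟨d - 1, by omega⟩
  have hpow : (n : ℝ) * (∑ i, x i) ^ (n - 1) * ∑ i, x i = n * (∑ i, x i) ^ n := by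
    cases n with
    | zero => simp
    | succ n => simp only [Nat.add_sub_cancel]; ring
  simp only [Nat.add_sub_cancel]
  generalize ∑ i, x i = s at *
  push_cast
  field_simp
  linear_combination Wk κ x * (1 - s) * xgrad f x * hpow

theorem pdd_angular_part {d : ℕ} (κ : Fin (d + 1) → ℝ) {f : (Fin d → ℝ) → ℝ}
    {x : Fin d → ℝ} (hf : ContDiffAt ℝ 2 f x) (hx : ∀ i, 0 < x i)
    (hs : ∑ i, x i < 1) {i j : Fin d} (hij : i ≠ j) :
    pdd i j (fun y => y i * y j * Wk κ y * pdd i j f y) x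
      = Wk κ x * (((κ i.castSucc + 1) * x j - (κ j.castSucc + 1) * x i) * (pd i f x - pd j f x)
        + x i * x j * (pd i (pd i f) x - 2 * pd i (pd j f) x + pd j (pd j f) x)) := by
  have hW := (hasFDerivAt_Wk κ hx hs).differentiableAt.hasFDerivAt
  have hP : HasFDerivAt (pdd i j f) _ x :=
    (differentiableAt_pd hf i).hasFDerivAt.sub (differentiableAt_pd hf j).hasFDerivAt
  have hWv : fderiv ℝ (Wk κ) x (Pi.single i 1 - Pi.single j 1)
      = Wk κ x * (κ i.castSucc * (x i)⁻¹ - κ j.castSucc * (x j)⁻¹) := by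
    rw [fderiv_Wk_apply κ hx hs]
    simp [mul_sub, Finset.sum_sub_distrib, Pi.single_apply]
  have hPv : ∀ k, fderiv ℝ (pd k f) x (Pi.single i 1 - Pi.single j 1)
      = pd i (pd k f) x - pd j (pd k f) x := fun k => map_sub _ _ _
  rw [pdd_eq_fderiv, HasFDerivAt.fderiv
    ((((hasFDerivAt_apply i x).fun_mul (hasFDerivAt_apply j x)).fun_mul hW).fun_mul hP)]
  simp only [add_apply, smul_apply,
    sub_apply, smul_eq_mul, hWv, hPv, ContinuousLinearMap.proj_apply,
    Pi.sub_apply, Pi.single_eq_same, Pi.single_eq_of_ne hij, Pi.single_eq_of_ne hij.symm,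
    pdd, pd_pd_comm hf j i]
  have hi := (hx i).ne'
  have hj := (hx j).ne'
  field_simp
  ring

theorem sum_lt_first_order {d : ℕ} (a x p : Fin d → ℝ) :
    ∑ i, ∑ j ∈ Finset.univ.filter (fun j => i < j), (a i * x j - a j * x i) * (p i - p j)
      = (∑ i, x i) * (∑ i, a i * p i) - (∑ i, a i) * ∑ i, x i * p i := by
  have h := two_mul_sum_sum_lt (fun i j => (a i * x j - a j * x i) * (p i - p j))
    (fun i j => by ring)
  have hfull : ∑ i, ∑ j, (a i * x j - a j * x i) * (p i - p j)
      = 2 * ((∑ i, x i) * (∑ i, a i * p i) - (∑ i, a i) * ∑ i, x i * p i) := by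
    have hexpand : ∀ i j, (a i * x j - a j * x i) * (p i - p j)
        = (a i * p i) * x j - a i * (x j * p j) - (x i * p i) * a j + x i * (a j * p j) := by
      intro i j; ring
    simp only [hexpand, Finset.sum_add_distrib, Finset.sum_sub_distrib, ← Finset.sum_mul_sum]
    ring
  simp only [sub_self, mul_zero, Finset.sum_const_zero, hfull] at h
  linarith

theorem sum_lt_second_order {d : ℕ} (x : Fin d → ℝ) (H : Fin d → Fin d → ℝ)
    (hH : ∀ i j, H i j = H j i) :
    ∑ i, ∑ j ∈ Finset.univ.filter (fun j => i < j), x i * x j * (H i i - 2 * H i j + H j j)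
      = (∑ i, x i) * (∑ i, x i * H i i) - ∑ i, ∑ j, x i * x j * H i j := by
  have h := two_mul_sum_sum_lt (fun i j => x i * x j * (H i i - 2 * H i j + H j j))
    (fun i j => by rw [hH i j]; ring)
  have hfull : ∑ i, ∑ j, x i * x j * (H i i - 2 * H i j + H j j)
      = 2 * ((∑ i, x i) * (∑ i, x i * H i i) - ∑ i, ∑ j, x i * x j * H i j) := by
    have hexpand : ∀ i j, x i * x j * (H i i - 2 * H i j + H j j)
        = (x i * H i i) * x j - 2 * (x i * x j * H i j) + x i * (x j * H j j) := by
      intro i j; ring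
    simp only [hexpand, Finset.sum_add_distrib, Finset.sum_sub_distrib, ← Finset.mul_sum,
      ← Finset.sum_mul]
    ring
  have hdiag : ∑ i, x i * x i * (H i i - 2 * H i i + H i i) = 0 :=
    Finset.sum_eq_zero fun i _ => by ring
  simp only [hfull, hdiag] at h
  linarith

theorem Dk_eq_full_sum {d : ℕ} (κ : Fin (d + 1) → ℝ) {f : (Fin d → ℝ) → ℝ}
    {x : Fin d → ℝ} (hf : ContDiffAt ℝ 2 f x) :
    Dk κ f x = (∑ i, x i * pd i (pd i f) x) - (∑ i, ∑ j, x i * x j * pd i (pd j f) x)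
      + (∑ i, (κ i.castSucc + 1) * pd i f x)
      - ((∑ i : Fin d, κ i.castSucc) + κ (Fin.last d) + d + 1) * xgrad f x := by
  have h := two_mul_sum_sum_lt (fun i j => x i * x j * pd i (pd j f) x)
    (fun i j => by rw [pd_pd_comm hf i j]; ring)
  rw [Dk, h, Fin.sum_univ_castSucc, xgrad]
  simp only [mul_sub, sub_mul, mul_one, Finset.sum_sub_distrib, Finset.mul_sum, mul_assoc]
  ring

/-- the new decomposition \eqref{eq:CD_k2} of the spectral operator. -/
theorem stmt7 (d : ℕ) (hd : 2 ≤ d) (κ : Fin (d+1) → ℝ) (hκ : ∀ i, 0 ≤ κ i)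
    (f : (Fin d → ℝ) → ℝ) (hf : ContDiffOn ℝ 2 f (Splx d))
    (x : Fin d → ℝ) (hx : x ∈ interior (Splx d)) :
    Dk κ f x = (1 / Wk κ x) *
      ((1 / (∑ k, x k) ^ d) *
          xgrad (fun y => (∑ k, y k) ^ (d - 1) * (1 - ∑ k, y k) * Wk κ y * xgrad f y) x +
       (1 / (∑ k, x k)) *
          ∑ i, ∑ j ∈ Finset.univ.filter (fun j => i < j),
            pdd i j (fun y => y i * y j * Wk κ y * pdd i j f y) x) := by
  have hd0 : 0 < d := by omega
  obtain ⟨hpos, hs⟩ := pos_and_sum_lt_one_of_mem_interior_Splx hd0 hx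
  have hfx : ContDiffAt ℝ 2 f x := hf.contDiffAt (mem_interior_iff_mem_nhds.1 hx)
  have hs0 : 0 < ∑ k, x k := Finset.sum_pos (fun i _ => hpos i) ⟨⟨0, hd0⟩, Finset.mem_univ _⟩
  have hW : Wk κ x ≠ 0 :=
    (mul_pos (Finset.prod_pos fun i _ => Real.rpow_pos_of_pos (hpos i) _)
      (Real.rpow_pos_of_pos (by linarith) _)).ne'
  have hang : ∑ i, ∑ j ∈ Finset.univ.filter (fun j => i < j),
      pdd i j (fun y => y i * y j * Wk κ y * pdd i j f y) x
      = Wk κ x * (((∑ i, x i) * (∑ i, (κ i.castSucc + 1) * pd i f x)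
          - (∑ i : Fin d, (κ i.castSucc + 1)) * ∑ i, x i * pd i f x)
        + ((∑ i, x i) * (∑ i, x i * pd i (pd i f) x)
          - ∑ i, ∑ j, x i * x j * pd i (pd j f) x)) := by
    rw [← sum_lt_first_order, ← sum_lt_second_order x (fun i j => pd i (pd j f) x)
      (fun i j => pd_pd_comm hfx i j)]
    simp only [← Finset.sum_add_distrib, Finset.mul_sum]
    refine Finset.sum_congr rfl fun i _ => Finset.sum_congr rfl fun j hj => ?_
    exact pdd_angular_part κ hfx hpos hs (Finset.mem_filter.1 hj).2.ne
  rw [hang, xgrad_radial_part κ hfx hd0 hpos hs, Dk_eq_full_sum κ hfx,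
    ← pow_sub_one_mul hd0.ne' (∑ k, x k)]
  simp only [Finset.sum_add_distrib, Finset.sum_const, Finset.card_univ, Fintype.card_fin,
    nsmul_eq_mul, mul_one, xgrad]
  have hs' := hs0.ne'
  field_simp
  ring
end
end

section
/- For d ≥ 2 and κ_i ≥ 0 (i = 1,…,d+1), and for all twice continuously differentiable functions f and g on △^d: − ∫_{△^d} D_κ f(x) · g(x) W_κ(x) dx = ∫_{△^d} ⟨x,∇⟩f(x) · ⟨x,∇⟩g(x) (1−|x|) W_κ(x) (dx/|x|) + Σ_{1≤i<j≤d} ∫_{△^d} ∂_{i,j} f(x) ∂_{i,j} g(x) x_i x_j W_κ(x) (dx/|x|). -/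
open MeasureTheory Finset

noncomputable section

/-- The interior of the simplex. -/
def interiorSplx (d : ℕ) : Set (Fin d → ℝ) := {x | (∀ i, 0 < x i) ∧ ∑ i, x i < 1}

/-- `h` agrees on the interior of the simplex with a function continuous up to the boundary. -/
def ExtendsContinuously {d : ℕ} (h : (Fin d → ℝ) → ℝ) : Prop :=
  ∃ h', ContinuousOn h' (Splx d) ∧ Set.EqOn h h' (interiorSplx d)

section Geometry

variable {d : ℕ}

theorem interiorSplx_subset : interiorSplx d ⊆ Splx d :=
  fun _ hx => ⟨fun i => (hx.1 i).le, hx.2.le⟩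

theorem isOpen_interiorSplx : IsOpen (interiorSplx d) := by
  have : interiorSplx d = (⋂ i, {x | 0 < x i}) ∩ {x | ∑ i, x i < 1} := by
    ext x; simp [interiorSplx]
  rw [this]
  exact (isOpen_iInter_of_finite fun i => isOpen_lt continuous_const (continuous_apply i)).inter
    (isOpen_lt (by fun_prop) continuous_const)

theorem isClosed_splx : IsClosed (Splx d) := by
  have : Splx d = (⋂ i, {x | 0 ≤ x i}) ∩ {x | ∑ i, x i ≤ 1} := by
    ext x; simp [Splx]
  rw [this]
  exact (isClosed_iInter fun i => isClosed_le continuous_const (continuous_apply i)).inter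
    (isClosed_le (by fun_prop) continuous_const)

theorem isCompact_splx : IsCompact (Splx d) := by
  refine (isCompact_univ_pi fun _ : Fin d => isCompact_Icc (a := (0 : ℝ)) (b := 1)).of_isClosed_subset
    isClosed_splx fun x hx i _ => ⟨hx.1 i, ?_⟩
  exact (Finset.single_le_sum (fun j _ => hx.1 j) (Finset.mem_univ i)).trans hx.2

theorem convex_splx : Convex ℝ (Splx d) := by
  intro x hx y hy a b ha hb hab
  refine ⟨fun i => ?_, ?_⟩
  · have := hx.1 i
    have := hy.1 i
    simp only [Pi.add_apply, Pi.smul_apply, smul_eq_mul]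
    positivity
  · simp only [Pi.add_apply, Pi.smul_apply, smul_eq_mul, Finset.sum_add_distrib,
      ← Finset.mul_sum]
    nlinarith [hx.2, hy.2, mul_le_mul_of_nonneg_left hx.2 ha, mul_le_mul_of_nonneg_left hy.2 hb]

theorem interiorSplx_nonempty : (interiorSplx d).Nonempty := by
  refine ⟨fun _ => 1 / ((d : ℝ) + 1), fun i => by positivity, ?_⟩
  rw [Finset.sum_const, Finset.card_univ, Fintype.card_fin, nsmul_eq_mul, mul_one_div,
    div_lt_one (by positivity)]
  linarith

theorem sum_pos_of_mem_interiorSplx (hd : 0 < d) {x : Fin d → ℝ} (hx : x ∈ interiorSplx d) :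
    0 < ∑ i, x i :=
  Finset.sum_pos (fun i _ => hx.1 i) ⟨⟨0, hd⟩, Finset.mem_univ _⟩

theorem interior_splx (hd : 0 < d) : interior (Splx d) = interiorSplx d := by
  refine Set.Subset.antisymm (fun x hx => ?_)
    (interior_maximal interiorSplx_subset isOpen_interiorSplx)
  have key : ∀ (i : Fin d) (s : ℝ), ∃ t > 0, x + (t * s) • Pi.single i 1 ∈ Splx d := by
    intro i s
    have hc : Filter.Tendsto (fun t : ℝ => x + (t * s) • (Pi.single i 1 : Fin d → ℝ))
        (nhdsWithin 0 (Set.Ioi 0)) (nhds x) := by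
      have : Continuous (fun t : ℝ => x + (t * s) • (Pi.single i 1 : Fin d → ℝ)) := by fun_prop
      simpa using (this.tendsto 0).mono_left nhdsWithin_le_nhds
    have := (hc.eventually (mem_interior_iff_mem_nhds.1 hx)).and self_mem_nhdsWithin
    obtain ⟨t, ht, ht0⟩ := this.exists
    exact ⟨t, ht0, ht⟩
  refine ⟨fun i => ?_, ?_⟩
  · obtain ⟨t, ht, h⟩ := key i (-1)
    have := h.1 i
    simp at this
    linarith
  · obtain ⟨t, ht, h⟩ := key ⟨0, hd⟩ 1
    have := h.2
    simp [Finset.sum_add_distrib, Pi.single_apply] at this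
    linarith

theorem uniqueDiffOn_splx : UniqueDiffOn ℝ (Splx d) :=
  uniqueDiffOn_convex convex_splx
    (interiorSplx_nonempty.mono (interior_maximal interiorSplx_subset isOpen_interiorSplx))

theorem splx_mem_nhds {x : Fin d → ℝ} (hx : x ∈ interiorSplx d) : Splx d ∈ nhds x :=
  Filter.mem_of_superset (isOpen_interiorSplx.mem_nhds hx) interiorSplx_subset

theorem setIntegral_splx (hd : 0 < d) (h : (Fin d → ℝ) → ℝ) :
    ∫ x in Splx d, h x = ∫ x in interiorSplx d, h x := by
  rw [← interior_splx hd]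
  exact setIntegral_congr_set
    (interior_ae_eq_of_null_frontier (convex_splx.addHaar_frontier volume)).symm

end Geometry

namespace ExtendsContinuously

variable {d : ℕ} {h k : (Fin d → ℝ) → ℝ}

theorem of_continuousOn (hh : ContinuousOn h (Splx d)) : ExtendsContinuously h :=
  ⟨h, hh, fun _ _ => rfl⟩

theorem add (hh : ExtendsContinuously h) (hk : ExtendsContinuously k) :
    ExtendsContinuously fun x => h x + k x := by
  obtain ⟨h', h1, h2⟩ := hh
  obtain ⟨k', k1, k2⟩ := hk
  exact ⟨_, h1.add k1, fun x hx => by simp [h2 hx, k2 hx]⟩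

theorem sub (hh : ExtendsContinuously h) (hk : ExtendsContinuously k) :
    ExtendsContinuously fun x => h x - k x := by
  obtain ⟨h', h1, h2⟩ := hh
  obtain ⟨k', k1, k2⟩ := hk
  exact ⟨_, h1.sub k1, fun x hx => by simp [h2 hx, k2 hx]⟩

theorem mul (hh : ExtendsContinuously h) (hk : ExtendsContinuously k) :
    ExtendsContinuously fun x => h x * k x := by
  obtain ⟨h', h1, h2⟩ := hh
  obtain ⟨k', k1, k2⟩ := hk
  exact ⟨_, h1.mul k1, fun x hx => by simp [h2 hx, k2 hx]⟩

theorem const (c : ℝ) : ExtendsContinuously fun _ : Fin d → ℝ => c :=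
  of_continuousOn continuousOn_const

theorem coord (i : Fin d) : ExtendsContinuously fun x : Fin d → ℝ => x i :=
  of_continuousOn (continuous_apply i).continuousOn

theorem sum {ι : Type*} (s : Finset ι) {h : ι → (Fin d → ℝ) → ℝ}
    (hh : ∀ i ∈ s, ExtendsContinuously (h i)) : ExtendsContinuously fun x => ∑ i ∈ s, h i x := by
  classical
  induction s using Finset.induction_on with
  | empty => simpa using const 0
  | insert a s ha ih =>
    simp only [Finset.sum_insert ha]
    exact (hh a (by simp)).add (ih fun i hi => hh i (by simp [hi]))

theorem continuousOn (hh : ExtendsContinuously h) : ContinuousOn h (interiorSplx d) := by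
  obtain ⟨h', h1, h2⟩ := hh
  exact (h1.mono interiorSplx_subset).congr h2

theorem integrableOn (hh : ExtendsContinuously h) : IntegrableOn h (interiorSplx d) := by
  obtain ⟨h', h1, h2⟩ := hh
  exact ((h1.integrableOn_compact isCompact_splx).mono_set interiorSplx_subset).congr_fun
    h2.symm isOpen_interiorSplx.measurableSet

end ExtendsContinuously

section Derivatives

variable {d : ℕ} {f g : (Fin d → ℝ) → ℝ} {x : Fin d → ℝ}

theorem pd_congr (i : Fin d) (h : f =ᶠ[nhds x] g) : pd i f x = pd i g x := by
  simp only [pd, h.fderiv_eq]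

theorem pd_mul (i : Fin d) (hf : DifferentiableAt ℝ f x) (hg : DifferentiableAt ℝ g x) :
    pd i (fun y => f y * g y) x = pd i f x * g x + f x * pd i g x := by
  simp only [pd, fderiv_fun_mul hf hg, add_apply,
    smul_apply, smul_eq_mul]
  ring

theorem pd_sub (i : Fin d) (hf : DifferentiableAt ℝ f x) (hg : DifferentiableAt ℝ g x) :
    pd i (fun y => f y - g y) x = pd i f x - pd i g x := by
  simp only [pd, fderiv_fun_sub hf hg, sub_apply]

theorem pd_sum {ι : Type*} (s : Finset ι) {f : ι → (Fin d → ℝ) → ℝ} (i : Fin d)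
    (hf : ∀ j ∈ s, DifferentiableAt ℝ (f j) x) :
    pd i (fun y => ∑ j ∈ s, f j y) x = ∑ j ∈ s, pd i (f j) x := by
  simp only [pd, fderiv_fun_sum hf, _root_.sum_apply]

theorem pd_coord (i j : Fin d) :
    pd i (fun y : Fin d → ℝ => y j) x = if j = i then 1 else 0 := by
  have : fderiv ℝ (fun y : Fin d → ℝ => y j) x = ContinuousLinearMap.proj j :=
    (ContinuousLinearMap.proj (R := ℝ) (φ := fun _ : Fin d => ℝ) j).fderiv
  simp [pd, this, Pi.single_apply]

theorem pd_comp {φ : ℝ → ℝ} (i : Fin d) (hφ : DifferentiableAt ℝ φ (f x))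
    (hf : DifferentiableAt ℝ f x) :
    pd i (fun y => φ (f y)) x = deriv φ (f x) * pd i f x := by
  have := (hφ.hasDerivAt.comp_hasFDerivAt x hf.hasFDerivAt).fderiv
  simp only [pd]
  change fderiv ℝ (φ ∘ f) x _ = _
  rw [this]
  simp

theorem contDiffAt_pd {n : WithTop ℕ∞} (i : Fin d) (hf : ContDiffAt ℝ (n + 1) f x) :
    ContDiffAt ℝ n (pd i f) x :=
  (hf.fderiv_right le_rfl).clm_apply contDiffAt_const

theorem pd_comm (i j : Fin d) (hf : ContDiffAt ℝ 2 f x) :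
    pd i (pd j f) x = pd j (pd i f) x := by
  have hd : DifferentiableAt ℝ (fderiv ℝ f) x :=
    (hf.fderiv_right (m := 1) (by norm_num)).differentiableAt (by norm_num)
  have key : ∀ v w : Fin d → ℝ,
      fderiv ℝ (fun y => fderiv ℝ f y w) x v = fderiv ℝ (fderiv ℝ f) x v w := by
    intro v w
    rw [fderiv_clm_apply hd (differentiableAt_const w)]
    simp
  have := hf.isSymmSndFDerivAt (by simp) (Pi.single i 1) (Pi.single j 1)
  rw [← key, ← key] at this
  exact this

theorem exists_contDiffOn_eqOn_pd {n : WithTop ℕ∞} (i : Fin d)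
    (hf : ContDiffOn ℝ (n + 1) f (Splx d)) :
    ∃ h, ContDiffOn ℝ n h (Splx d) ∧ Set.EqOn (pd i f) h (interiorSplx d) := by
  refine ⟨fun x => fderivWithin ℝ f (Splx d) x (Pi.single i 1),
    (hf.fderivWithin uniqueDiffOn_splx le_rfl).clm_apply contDiffOn_const, fun x hx => ?_⟩
  simp only [pd, fderivWithin_of_mem_nhds (splx_mem_nhds hx)]

theorem extendsContinuously_pd (i : Fin d) (hf : ContDiffOn ℝ 2 f (Splx d)) :
    ExtendsContinuously (pd i f) := by
  obtain ⟨h, h1, h2⟩ := exists_contDiffOn_eqOn_pd (n := 1) i (by simpa [one_add_one_eq_two] using hf)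
  exact ⟨h, h1.continuousOn, h2⟩

theorem extendsContinuously_pd_pd (i j : Fin d) (hf : ContDiffOn ℝ 2 f (Splx d)) :
    ExtendsContinuously (pd i (pd j f)) := by
  obtain ⟨h, h1, h2⟩ := exists_contDiffOn_eqOn_pd (n := 1) j (by simpa [one_add_one_eq_two] using hf)
  obtain ⟨k, k1, k2⟩ := exists_contDiffOn_eqOn_pd (n := 0) i (by simpa using h1)
  refine ⟨k, k1.continuousOn, fun x hx => ?_⟩
  rw [← k2 hx]
  exact pd_congr i (h2.eventuallyEq_of_mem (isOpen_interiorSplx.mem_nhds hx))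

end Derivatives

/-- The integral of a partial derivative of a `C¹` function vanishing off a compact subset of an
open set is zero. -/
theorem integral_pd_eq_zero {d : ℕ} {U K : Set (Fin d → ℝ)} (hU : IsOpen U) (hK : IsCompact K)
    (hKU : K ⊆ U) {G : (Fin d → ℝ) → ℝ} (hG : ∀ x ∈ U, ContDiffAt ℝ 1 G x)
    (hG0 : ∀ x ∈ U, x ∉ K → G x = 0) (i : Fin d) :
    IntegrableOn (pd i G) U ∧ ∫ x in U, pd i G x = 0 := by
  set F := U.indicator G with hF
  have hF0 : ∀ x, x ∉ K → F =ᶠ[nhds x] fun _ => 0 := by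
    intro x hx
    filter_upwards [hK.isClosed.isOpen_compl.mem_nhds hx] with y hy
    by_cases hyU : y ∈ U
    · simp [hF, hyU, hG0 y hyU hy]
    · simp [hF, hyU]
  have hFG : ∀ x ∈ U, F =ᶠ[nhds x] G := by
    intro x hx
    filter_upwards [hU.mem_nhds hx] with y hy
    simp [hF, hy]
  have hFC : ContDiff ℝ 1 F := by
    rw [contDiff_iff_contDiffAt]
    intro x
    by_cases hx : x ∈ U
    · exact (hG x hx).congr_of_eventuallyEq (hFG x hx)
    · exact contDiffAt_const.congr_of_eventuallyEq (hF0 x fun h => hx (hKU h))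
  have hFs : HasCompactSupport F := HasCompactSupport.intro hK fun x hx => (hF0 x hx).self_of_nhds
  have hFint : Integrable fun x => fderiv ℝ F x (Pi.single i 1) :=
    ((hFC.continuous_fderiv (by norm_num)).clm_apply continuous_const).integrable_of_hasCompactSupport
      (hFs.fderiv_apply (𝕜 := ℝ) _)
  have hzero : ∫ x, fderiv ℝ F x (Pi.single i 1) = 0 := by
    have := integral_mul_fderiv_eq_neg_fderiv_mul_of_integrable (μ := volume)
      (f := fun _ : Fin d → ℝ => (1 : ℝ)) (g := F) (v := Pi.single i 1) (by simp)
      (by simpa using hFint)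
      (by simpa using hFC.continuous.integrable_of_hasCompactSupport hFs)
      (fun x _ => differentiableAt_const _)
      (fun x _ => hFC.differentiable (by norm_num) x)
    simpa using this
  have heq : Set.EqOn (pd i F) (pd i G) U := fun x hx => pd_congr i (hFG x hx)
  refine ⟨(hFint.integrableOn (s := U)).congr_fun heq hU.measurableSet, ?_⟩
  rw [← setIntegral_congr_fun hU.measurableSet heq,
    setIntegral_eq_integral_of_forall_compl_eq_zero]
  · exact hzero
  · intro x hx
    have := (hF0 x fun h => hx (hKU h)).fderiv_eq (𝕜 := ℝ)
    simp [pd, this]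

/-- Smooth cutoffs increasing to the indicator of `(0, ∞)`, with derivative `O(1 / s)`. -/
theorem exists_cutoff : ∃ (Φ : ℕ → ℝ → ℝ) (C : ℝ), (∀ n, ContDiff ℝ 1 (Φ n)) ∧
    (∀ n, ∃ ε > 0, ∀ s < ε, Φ n s = 0) ∧ (∀ n s, |Φ n s| ≤ 1) ∧
    (∀ n s, |deriv (Φ n) s * s| ≤ C) ∧
    ∀ s > 0, ∀ᶠ n in Filter.atTop, Φ n s = 1 ∧ deriv (Φ n) s = 0 := by
  have hσ : ContDiff ℝ 1 Real.smoothTransition := Real.smoothTransition.contDiff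
  have hσ' : Continuous (deriv Real.smoothTransition) := hσ.continuous_deriv le_rfl
  have hl : ∀ t < 0, deriv Real.smoothTransition t = 0 := by
    intro t ht
    have : Real.smoothTransition =ᶠ[nhds t] fun _ => 0 := by
      filter_upwards [Iio_mem_nhds ht] with s hs
      exact Real.smoothTransition.zero_of_nonpos hs.le
    simp [this.deriv_eq]
  have hr : ∀ t > 1, deriv Real.smoothTransition t = 0 := by
    intro t ht
    have : Real.smoothTransition =ᶠ[nhds t] fun _ => 1 := by
      filter_upwards [Ioi_mem_nhds ht] with s hs
      exact Real.smoothTransition.one_of_one_le (le_of_lt hs)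
    simp [this.deriv_eq]
  obtain ⟨M, hM⟩ := (isCompact_Icc (a := (0 : ℝ)) (b := 1)).exists_bound_of_continuousOn
    (f := fun t => deriv Real.smoothTransition t * (t + 1)) (by fun_prop)
  have hM0 : 0 ≤ M := (norm_nonneg _).trans (hM 0 (by simp))
  have hMM : ∀ t, |deriv Real.smoothTransition t * (t + 1)| ≤ M := by
    intro t
    rcases lt_or_ge t 0 with h | h
    · simpa [hl t h] using hM0
    rcases lt_or_ge 1 t with h' | h'
    · simpa [hr t h'] using hM0
    exact hM t ⟨h, h'⟩
  have hderiv : ∀ (n : ℕ) (s : ℝ),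
      deriv (fun s => Real.smoothTransition ((n + 1 : ℝ) * s - 1)) s =
        deriv Real.smoothTransition ((n + 1 : ℝ) * s - 1) * (n + 1) := by
    intro n s
    have h1 := (hσ.differentiable (by norm_num) ((n + 1 : ℝ) * s - 1)).hasDerivAt
    have h2 : HasDerivAt (fun s : ℝ => (n + 1 : ℝ) * s - 1) (n + 1) s := by
      simpa using ((hasDerivAt_id s).const_mul (n + 1 : ℝ)).sub_const 1
    exact (h1.comp s h2).deriv
  refine ⟨fun n s => Real.smoothTransition ((n + 1 : ℝ) * s - 1), M, fun n => ?_, fun n => ?_,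
    fun n s => ?_, fun n s => ?_, fun s hs => ?_⟩
  · exact hσ.comp (by fun_prop)
  · refine ⟨1 / (n + 1 : ℝ), by positivity, fun s hs => ?_⟩
    rw [lt_div_iff₀ (by positivity)] at hs
    exact Real.smoothTransition.zero_of_nonpos (by linarith)
  · rw [abs_of_nonneg (Real.smoothTransition.nonneg _)]
    exact Real.smoothTransition.le_one _
  · rw [hderiv]
    have := hMM ((n + 1 : ℝ) * s - 1)
    rwa [show deriv Real.smoothTransition ((n + 1 : ℝ) * s - 1) * ((n + 1 : ℝ) * s - 1 + 1) =
      deriv Real.smoothTransition ((n + 1 : ℝ) * s - 1) * (n + 1) * s by ring] at this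
  · obtain ⟨N, hN⟩ := exists_nat_gt (2 / s)
    filter_upwards [Filter.eventually_ge_atTop N] with n hn
    have : 1 < (n + 1 : ℝ) * s - 1 := by
      have h1 : (N : ℝ) ≤ n := by exact_mod_cast hn
      rw [div_lt_iff₀ hs] at hN
      nlinarith
    exact ⟨Real.smoothTransition.one_of_one_le this.le, by rw [hderiv, hr _ this, zero_mul]⟩

section Weight

variable {d : ℕ} {x : Fin d → ℝ}

theorem continuous_Wk {κ : Fin (d+1) → ℝ} (hκ : ∀ i, 0 ≤ κ i) : Continuous (Wk κ) := by
  refine (continuous_finsetProd _ fun i _ => ?_).mul ?_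
  · exact (continuous_apply i).rpow_const fun _ => Or.inr (hκ _)
  · exact Continuous.rpow_const (by fun_prop) fun _ => Or.inr (hκ _)

theorem contDiffAt_Wk (κ : Fin (d+1) → ℝ) (hx : x ∈ interiorSplx d) {n : WithTop ℕ∞} :
    ContDiffAt ℝ n (Wk κ) x := by
  refine (contDiffAt_prod fun i _ => ?_).mul ?_
  · exact (contDiff_apply ℝ ℝ i).contDiffAt.rpow_const_of_ne (hx.1 i).ne'
  · exact ContDiffAt.rpow_const_of_ne (by fun_prop) (sub_pos.2 hx.2).ne'

theorem pd_Wk (κ : Fin (d+1) → ℝ) (hx : x ∈ interiorSplx d) (i : Fin d) :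
    pd i (Wk κ) x = Wk κ x * (κ i.castSucc / x i - κ (Fin.last d) / (1 - ∑ k, x k)) := by
  set L : (Fin d → ℝ) → ℝ := fun y =>
    ∑ j, Real.log (y j) * κ j.castSucc + Real.log (1 - ∑ j, y j) * κ (Fin.last d) with hL
  have heq : ∀ y ∈ interiorSplx d, Wk κ y = Real.exp (L y) := by
    intro y hy
    rw [hL, Real.exp_add, Real.exp_sum, Wk, Real.rpow_def_of_pos (sub_pos.2 hy.2)]
    congr 1
    exact Finset.prod_congr rfl fun j _ => Real.rpow_def_of_pos (hy.1 j) _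
  have hproj : ∀ j : Fin d, HasFDerivAt (fun y : Fin d → ℝ => y j)
      (ContinuousLinearMap.proj j : (Fin d → ℝ) →L[ℝ] ℝ) x := fun j =>
    (ContinuousLinearMap.proj (R := ℝ) (φ := fun _ : Fin d => ℝ) j).hasFDerivAt
  have hsum : HasFDerivAt (fun y : Fin d → ℝ => 1 - ∑ j, y j)
      (-∑ j, (ContinuousLinearMap.proj j : (Fin d → ℝ) →L[ℝ] ℝ)) x :=
    (HasFDerivAt.fun_sum fun j _ => hproj j).const_sub 1
  have hLd := (HasFDerivAt.fun_sum (u := Finset.univ) fun j _ =>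
    ((hproj j).log (hx.1 j).ne').mul_const (κ j.castSucc)).add
    ((hsum.log (sub_pos.2 hx.2).ne').mul_const (κ (Fin.last d)))
  have hev : Wk κ =ᶠ[nhds x] fun y => Real.exp (L y) :=
    Filter.eventually_of_mem (isOpen_interiorSplx.mem_nhds hx) heq
  rw [pd_congr i hev, pd]
  have := hLd.exp.fderiv
  rw [show fderiv ℝ (fun y => Real.exp (L y)) x = _ from this]
  rw [heq x hx]
  simp [hL, Pi.single_apply]
  ring

theorem sum_filter_lt_add_diag (a : Fin d → Fin d → ℝ) (ha : ∀ i j, a i j = a j i) :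
    ∑ i, ∑ j, a i j = ∑ i, a i i + 2 * ∑ i, ∑ j ∈ Finset.univ.filter (fun j => i < j), a i j := by
  have h1 : ∑ i, ∑ j ∈ Finset.univ.filter (fun j => i < j), a i j =
      ∑ i, ∑ j ∈ Finset.univ.filter (fun j => j < i), a i j := by
    simp only [Finset.sum_filter]
    rw [Finset.sum_comm]
    simp only [ha]
  rw [two_mul]
  nth_rewrite 2 [h1]
  rw [← Finset.sum_add_distrib, ← Finset.sum_add_distrib]
  refine Finset.sum_congr rfl fun i _ => ?_
  have hdiag : a i i = ∑ j, if j = i then a i j else 0 := by simp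
  rw [hdiag, Finset.sum_filter, Finset.sum_filter, ← Finset.sum_add_distrib,
    ← Finset.sum_add_distrib]
  refine Finset.sum_congr rfl fun j _ => ?_
  rcases lt_trichotomy i j with h | h | h
  · simp [h, h.ne', h.not_gt]
  · simp [h]
  · simp [h, h.ne, h.not_gt]

end Weight

/-- The components of the vector field whose weighted divergence is the spectral operator. -/
def drift {d : ℕ} (f : (Fin d → ℝ) → ℝ) (i : Fin d) (x : Fin d → ℝ) : ℝ :=
  x i * (pd i f x - xgrad f x)

section Divergence

variable {d : ℕ} {f g : (Fin d → ℝ) → ℝ} {x : Fin d → ℝ}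

theorem contDiffAt_xgrad (hf : ContDiffAt ℝ 2 f x) : ContDiffAt ℝ 1 (xgrad f) x :=
  ContDiffAt.sum fun i _ => (contDiff_apply ℝ ℝ i).contDiffAt.mul
    (contDiffAt_pd i (by simpa [one_add_one_eq_two] using hf))

theorem contDiffAt_drift (hf : ContDiffAt ℝ 2 f x) (i : Fin d) : ContDiffAt ℝ 1 (drift f i) x :=
  (contDiff_apply ℝ ℝ i).contDiffAt.mul
    ((contDiffAt_pd i (by simpa [one_add_one_eq_two] using hf)).sub (contDiffAt_xgrad hf))

theorem pd_xgrad (hf : ContDiffAt ℝ 2 f x) (i : Fin d) :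
    pd i (xgrad f) x = pd i f x + ∑ j, x j * pd i (pd j f) x := by
  have hpd : ∀ j, DifferentiableAt ℝ (pd j f) x := fun j =>
    (contDiffAt_pd (n := 1) j (by simpa [one_add_one_eq_two] using hf)).differentiableAt
      (by norm_num)
  have hc : ∀ j : Fin d, DifferentiableAt ℝ (fun y : Fin d → ℝ => y j) x := fun j => by fun_prop
  have : pd i (xgrad f) x = ∑ j, pd i (fun y => y j * pd j f y) x :=
    pd_sum Finset.univ i fun j _ => (hc j).mul (hpd j)
  rw [this]
  simp only [pd_mul i (hc _) (hpd _), pd_coord, Finset.sum_add_distrib, ite_mul, one_mul, zero_mul,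
    Finset.sum_ite_eq', Finset.mem_univ, if_true]

theorem sum_pd_drift (hf : ContDiffAt ℝ 2 f x) :
    ∑ i, pd i (drift f i) x = ∑ i, pd i f x + ∑ i, x i * pd i (pd i f) x
      - (∑ i, ∑ j, x i * x j * pd i (pd j f) x) - ((d : ℝ) + 1) * xgrad f x := by
  have hpd : ∀ j, DifferentiableAt ℝ (pd j f) x := fun j =>
    (contDiffAt_pd (n := 1) j (by simpa [one_add_one_eq_two] using hf)).differentiableAt
      (by norm_num)
  have hx : DifferentiableAt ℝ (xgrad f) x := (contDiffAt_xgrad hf).differentiableAt (by norm_num)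
  have hc : ∀ j : Fin d, DifferentiableAt ℝ (fun y : Fin d → ℝ => y j) x := fun j => by fun_prop
  have key : ∀ i, pd i (drift f i) x = pd i f x + x i * pd i (pd i f) x
      - ∑ j, x i * x j * pd i (pd j f) x - xgrad f x - x i * pd i f x := by
    intro i
    have h1 : pd i (drift f i) x = _ := pd_mul i (hc i) ((hpd i).sub hx)
    have h2 := pd_sub i (hpd i) hx
    rw [h1, h2, pd_xgrad hf, pd_coord]
    simp only [if_true, mul_assoc, ← Finset.mul_sum]
    ring
  simp only [key, Finset.sum_sub_distrib, Finset.sum_add_distrib]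
  simp only [Finset.sum_const, Finset.card_univ, Fintype.card_fin, nsmul_eq_mul, xgrad]
  ring

theorem sum_pd_Wk_mul_drift (κ : Fin (d+1) → ℝ) (hx : x ∈ interiorSplx d) :
    ∑ i, pd i (Wk κ) x * drift f i x =
      Wk κ x * (∑ i : Fin d, κ i.castSucc * pd i f x - (∑ k, κ k) * xgrad f x) := by
  have hs : 1 - ∑ k, x k ≠ 0 := (sub_pos.2 hx.2).ne'
  have key : ∀ i, pd i (Wk κ) x * drift f i x = Wk κ x * (κ i.castSucc * pd i f x
      - κ i.castSucc * xgrad f x - κ (Fin.last d) / (1 - ∑ k, x k) * (x i * pd i f x)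
      + κ (Fin.last d) / (1 - ∑ k, x k) * xgrad f x * x i) := by
    intro i
    have := (hx.1 i).ne'
    rw [pd_Wk κ hx, drift]
    field_simp
    ring
  simp only [key, ← Finset.mul_sum, Finset.sum_sub_distrib, Finset.sum_add_distrib,
    Fin.sum_univ_castSucc κ, ← Finset.sum_mul]
  rw [show ∑ i, x i * pd i f x = xgrad f x from rfl]
  field_simp
  ring

theorem Dk_eq (κ : Fin (d+1) → ℝ) (hf : ContDiffAt ℝ 2 f x) :
    Dk κ f x = ∑ i, pd i (drift f i) x
      + (∑ i : Fin d, κ i.castSucc * pd i f x - (∑ k, κ k) * xgrad f x) := by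
  have h := sum_filter_lt_add_diag (fun i j => x i * x j * pd i (pd j f) x) fun i j => by
    rw [pd_comm i j hf]; ring
  rw [sum_pd_drift hf, h, Dk]
  have h1 : ∑ i, x i * (1 - x i) * pd i (pd i f) x =
      ∑ i, x i * pd i (pd i f) x - ∑ i, x i * x i * pd i (pd i f) x := by
    rw [← Finset.sum_sub_distrib]
    exact Finset.sum_congr rfl fun i _ => by ring
  have h2 : ∑ i, (κ i.castSucc + 1 - ((∑ k, κ k) + (d : ℝ) + 1) * x i) * pd i f x =
      ∑ i : Fin d, κ i.castSucc * pd i f x + ∑ i, pd i f x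
        - ((∑ k, κ k) + (d : ℝ) + 1) * xgrad f x := by
    rw [xgrad, Finset.mul_sum, ← Finset.sum_add_distrib, ← Finset.sum_sub_distrib]
    exact Finset.sum_congr rfl fun i _ => by ring
  rw [h1, h2]
  ring

/-- The weighted divergence of `g` times the drift field of `f`. -/
theorem sum_pd_weighted_drift (κ : Fin (d+1) → ℝ) (hx : x ∈ interiorSplx d)
    (hf : ContDiffAt ℝ 2 f x) (hg : ContDiffAt ℝ 2 g x) :
    ∑ i, pd i (fun y => Wk κ y * (g y * drift f i y)) x =
      Dk κ f x * g x * Wk κ x + (∑ i, x i * pd i f x * pd i g x - xgrad f x * xgrad g x) * Wk κ x := by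
  have hW : DifferentiableAt ℝ (Wk κ) x := (contDiffAt_Wk κ hx (n := 1)).differentiableAt (by norm_num)
  have hg' : DifferentiableAt ℝ g x := hg.differentiableAt (by norm_num)
  have hd : ∀ i, DifferentiableAt ℝ (drift f i) x := fun i =>
    (contDiffAt_drift hf i).differentiableAt (by norm_num)
  have key : ∀ i, pd i (fun y => Wk κ y * (g y * drift f i y)) x =
      g x * (pd i (Wk κ) x * drift f i x) + Wk κ x * (pd i g x * drift f i x)
        + Wk κ x * g x * pd i (drift f i) x := by
    intro i
    rw [pd_mul i hW (hg'.fun_mul (hd i)), pd_mul i hg' (hd i)]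
    ring
  have hB : ∑ i, pd i g x * drift f i x = ∑ i, x i * pd i f x * pd i g x - xgrad f x * xgrad g x := by
    conv_rhs => rw [xgrad.eq_def g, Finset.mul_sum, ← Finset.sum_sub_distrib]
    exact Finset.sum_congr rfl fun i _ => by rw [drift]; ring
  simp only [key, Finset.sum_add_distrib, ← Finset.mul_sum]
  rw [sum_pd_Wk_mul_drift κ hx, hB, Dk_eq κ hf]
  ring

theorem extendsContinuously_xgrad (hf : ContDiffOn ℝ 2 f (Splx d)) :
    ExtendsContinuously (xgrad f) :=
  .sum _ fun i _ => (ExtendsContinuously.coord i).mul (extendsContinuously_pd i hf)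

theorem extendsContinuously_Dk (κ : Fin (d+1) → ℝ) (hf : ContDiffOn ℝ 2 f (Splx d)) :
    ExtendsContinuously (Dk κ f) := by
  refine .add (.sub (.sum _ fun i _ => ?_) ((ExtendsContinuously.const 2).mul
    (.sum _ fun i _ => .sum _ fun j _ => ?_))) (.sum _ fun i _ => ?_)
  · exact (((ExtendsContinuously.coord i).mul
      ((ExtendsContinuously.const 1).sub (.coord i))).mul (extendsContinuously_pd_pd i i hf))
  · exact (((ExtendsContinuously.coord i).mul (.coord j)).mul (extendsContinuously_pd_pd i j hf))
  · exact (((ExtendsContinuously.const _).sub ((ExtendsContinuously.const _).mul (.coord i))).mul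
      (extendsContinuously_pd i hf))

/-- The Green identity for the spectral operator, in terms of the Dirichlet form
`∑ xᵢ ∂ᵢf ∂ᵢg - ⟨x,∇⟩f ⟨x,∇⟩g`. -/
theorem integral_Dk_add_dirichlet {κ : Fin (d+1) → ℝ} (hκ : ∀ i, 0 ≤ κ i)
    (hf : ContDiffOn ℝ 2 f (Splx d)) (hg : ContDiffOn ℝ 2 g (Splx d)) :
    ∫ x in interiorSplx d, (Dk κ f x * g x * Wk κ x
      + (∑ i, x i * pd i f x * pd i g x - xgrad f x * xgrad g x) * Wk κ x) = 0 := by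
  have hf' : ∀ x ∈ interiorSplx d, ContDiffAt ℝ 2 f x := fun x hx => hf.contDiffAt (splx_mem_nhds hx)
  have hg' : ∀ x ∈ interiorSplx d, ContDiffAt ℝ 2 g x := fun x hx => hg.contDiffAt (splx_mem_nhds hx)
  have eg := ExtendsContinuously.of_continuousOn hg.continuousOn
  have eW := ExtendsContinuously.of_continuousOn (continuous_Wk hκ).continuousOn
  have exf := extendsContinuously_xgrad hf
  have exg := extendsContinuously_xgrad hg
  have ef := fun i => extendsContinuously_pd i hf
  have eg' := fun i => extendsContinuously_pd i hg
  set A : (Fin d → ℝ) → ℝ := fun x => Dk κ f x * g x * Wk κ x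
      + (∑ i, x i * pd i f x * pd i g x - xgrad f x * xgrad g x) * Wk κ x with hA
  have eA : ExtendsContinuously A := by
    refine .add (.mul (.mul (extendsContinuously_Dk κ hf) eg) eW) (.mul (.sub (.sum _ fun i _ => ?_)
      (.mul exf exg)) eW)
    exact .mul (.mul (.coord i) (ef i)) (eg' i)
  set P : (Fin d → ℝ) → ℝ := Wk fun _ => 1 with hP
  have hPc : Continuous P := continuous_Wk fun _ => zero_le_one
  have hP0 : ∀ x ∈ interiorSplx d, 0 < P x := fun x hx =>
    mul_pos (Finset.prod_pos fun i _ => Real.rpow_pos_of_pos (hx.1 i) _)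
      (Real.rpow_pos_of_pos (sub_pos.2 hx.2) _)
  have hP1 : ∀ x ∈ Splx d, 0 < P x → x ∈ interiorSplx d := by
    intro x hx hpos
    have hne : P x ≠ 0 := hpos.ne'
    simp only [hP, Wk, Real.rpow_one, mul_ne_zero_iff, Finset.prod_ne_zero_iff] at hne
    exact ⟨fun i => lt_of_le_of_ne (hx.1 i) (hne.1 i (Finset.mem_univ i)).symm,
      lt_of_le_of_ne hx.2 fun h => hne.2 (by rw [h, sub_self])⟩
  set T : (Fin d → ℝ) → ℝ := fun x =>
    (∑ i, pd i f x - ((d : ℝ) + 1) * xgrad f x) * g x * Wk κ x with hT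
  have eT : ExtendsContinuously T :=
    .mul (.mul (.sub (.sum _ fun i _ => ef i) (.mul (.const _) exf)) eg) eW
  obtain ⟨Φ, C, hΦ, hΦ0, hΦ1, hΦC, hΦlim⟩ := exists_cutoff
  have hsum : ∀ n, ∀ x ∈ interiorSplx d,
      ∑ i, pd i (fun y => Φ n (P y) * (Wk κ y * (g y * drift f i y))) x =
        Φ n (P x) * A x + deriv (Φ n) (P x) * P x * T x := by
    intro n x hx
    have hPd : DifferentiableAt ℝ P x := (contDiffAt_Wk _ hx (n := 1)).differentiableAt (by norm_num)
    have hΦd : DifferentiableAt ℝ (Φ n) (P x) := (hΦ n).differentiable (by norm_num) _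
    have hWd : ∀ i, DifferentiableAt ℝ (fun y => Wk κ y * (g y * drift f i y)) x := fun i =>
      ((contDiffAt_Wk κ hx (n := 1)).differentiableAt (by norm_num)).mul
        (((hg' x hx).differentiableAt (by norm_num)).mul
          ((contDiffAt_drift (hf' x hx) i).differentiableAt (by norm_num)))
    have hterm : ∀ i, pd i (fun y => Φ n (P y) * (Wk κ y * (g y * drift f i y))) x =
        deriv (Φ n) (P x) * Wk κ x * g x * (pd i P x * drift f i x)
          + Φ n (P x) * pd i (fun y => Wk κ y * (g y * drift f i y)) x := by
      intro i
      rw [pd_mul i (hΦd.fun_comp' x hPd) (hWd i), pd_comp i hΦd hPd]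
      ring
    simp only [hterm, Finset.sum_add_distrib, ← Finset.mul_sum]
    rw [sum_pd_weighted_drift κ hx (hf' x hx) (hg' x hx), hP, sum_pd_Wk_mul_drift _ hx]
    simp [hA, hT]
    ring
  have hzero : ∀ n, ∫ x in interiorSplx d,
      (Φ n (P x) * A x + deriv (Φ n) (P x) * P x * T x) = 0 := by
    intro n
    obtain ⟨ε, hε, hΦε⟩ := hΦ0 n
    have hK : IsCompact (Splx d ∩ {x | ε ≤ P x}) :=
      isCompact_splx.inter_right (isClosed_le continuous_const hPc)
    have hI := fun i => integral_pd_eq_zero isOpen_interiorSplx hK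
      (fun x hx => hP1 x hx.1 (hε.trans_le hx.2))
      (G := fun y => Φ n (P y) * (Wk κ y * (g y * drift f i y)))
      (fun x hx => ((hΦ n).contDiffAt.comp x (contDiffAt_Wk _ hx)).mul ((contDiffAt_Wk κ hx).mul
        (((hg' x hx).of_le (by norm_num)).mul (contDiffAt_drift (hf' x hx) i))))
      (fun x hx hxK => by
        have : P x < ε := by
          by_contra! h
          exact hxK ⟨interiorSplx_subset hx, h⟩
        simp [hΦε _ this]) i
    rw [← setIntegral_congr_fun isOpen_interiorSplx.measurableSet (hsum n),
      integral_finsetSum _ fun i _ => (hI i).1]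
    exact Finset.sum_eq_zero fun i _ => (hI i).2
  have hmeas : ∀ {h : (Fin d → ℝ) → ℝ}, ContinuousOn h (interiorSplx d) →
      AEStronglyMeasurable h (volume.restrict (interiorSplx d)) := fun h =>
    h.aestronglyMeasurable isOpen_interiorSplx.measurableSet
  have hlim := tendsto_integral_of_dominated_convergence
    (μ := volume.restrict (interiorSplx d))
    (F := fun n x => Φ n (P x) * A x + deriv (Φ n) (P x) * P x * T x) (f := A)
    (fun x => |A x| + C * |T x|)
    (fun n => hmeas ((((hΦ n).continuous.comp hPc).continuousOn.mul eA.continuousOn).add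
      (((((hΦ n).continuous_deriv le_rfl).comp hPc).mul hPc).continuousOn.mul eT.continuousOn)))
    (eA.integrableOn.abs.add (eT.integrableOn.abs.const_mul C))
    (fun n => Filter.Eventually.of_forall fun x => ?_)
    ((ae_restrict_iff' isOpen_interiorSplx.measurableSet).2
      (Filter.Eventually.of_forall fun x hx => ?_))
  · simp only [hzero] at hlim
    exact tendsto_nhds_unique hlim tendsto_const_nhds
  · refine (norm_add_le _ _).trans ?_
    simp only [Real.norm_eq_abs, abs_mul (Φ n (P x)), abs_mul _ (T x)]
    exact add_le_add (mul_le_of_le_one_left (abs_nonneg _) (hΦ1 _ _))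
      (mul_le_mul_of_nonneg_right (hΦC _ _) (abs_nonneg _))
  · refine tendsto_const_nhds.congr' ?_
    filter_upwards [hΦlim _ (hP0 x hx)] with n hn
    simp [hn.1, hn.2]

theorem ExtendsContinuously.integrableOn_coord_div_sum_mul {h : (Fin d → ℝ) → ℝ}
    (hh : ExtendsContinuously h) (hd : 0 < d) (i : Fin d) :
    IntegrableOn (fun x => x i / (∑ k, x k) * h x) (interiorSplx d) := by
  have hm := isOpen_interiorSplx (d := d).measurableSet
  refine hh.integrableOn.bdd_mul (c := 1) ?_ ?_
  · refine ContinuousOn.aestronglyMeasurable ?_ hm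
    exact (continuous_apply i).continuousOn.div (by fun_prop)
      fun x hx => (sum_pos_of_mem_interiorSplx hd hx).ne'
  · refine (ae_restrict_iff' hm).2 (Filter.Eventually.of_forall fun x hx => ?_)
    have hs := sum_pos_of_mem_interiorSplx hd hx
    rw [Real.norm_of_nonneg (div_nonneg (hx.1 i).le hs.le), div_le_one hs]
    exact Finset.single_le_sum (fun j _ => (hx.1 j).le) (Finset.mem_univ i)

/-- The Dirichlet form decomposed into radial and angular parts. -/
theorem dirichlet_decomposition (w : ℝ) (hs : ∑ k, x k ≠ 0) :
    xgrad f x * xgrad g x * (1 - ∑ k, x k) * w / (∑ k, x k) +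
      ∑ i, ∑ j ∈ Finset.univ.filter (fun j => i < j),
        pdd i j f x * pdd i j g x * x i * x j * w / (∑ k, x k) =
      (∑ i, x i * pd i f x * pd i g x - xgrad f x * xgrad g x) * w := by
  have h := sum_filter_lt_add_diag (fun i j => pdd i j f x * pdd i j g x * x i * x j)
    fun i j => by simp only [pdd]; ring
  have h0 : ∑ i, pdd i i f x * pdd i i g x * x i * x i = 0 := by simp [pdd]
  have h1 : ∑ i, ∑ j, pdd i j f x * pdd i j g x * x i * x j =
      2 * ((∑ k, x k) * ∑ i, x i * pd i f x * pd i g x - xgrad f x * xgrad g x) := by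
    have e : ∀ i j, pdd i j f x * pdd i j g x * x i * x j =
        (x i * pd i f x * pd i g x) * x j + x i * (x j * pd j f x * pd j g x)
          - (x i * pd i f x) * (x j * pd j g x) - (x i * pd i g x) * (x j * pd j f x) := by
      intro i j; simp only [pdd]; ring
    simp only [e, Finset.sum_sub_distrib, Finset.sum_add_distrib, ← Finset.sum_mul_sum, xgrad]
    ring
  rw [h0, h1] at h
  have h2 : ∑ i, ∑ j ∈ Finset.univ.filter (fun j => i < j),
        pdd i j f x * pdd i j g x * x i * x j * w / (∑ k, x k) =
      (∑ i, ∑ j ∈ Finset.univ.filter (fun j => i < j), pdd i j f x * pdd i j g x * x i * x j)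
        * w / (∑ k, x k) := by
    simp only [Finset.sum_mul, Finset.sum_div]
  rw [h2, show (∑ i, ∑ j ∈ Finset.univ.filter (fun j => i < j),
    pdd i j f x * pdd i j g x * x i * x j) = (∑ k, x k) * ∑ i, x i * pd i f x * pd i g x -
      xgrad f x * xgrad g x by linarith]
  field_simp
  ring

end Divergence

/-- the integral identity \eqref{eq:self-adj2}. -/
theorem stmt9 (d : ℕ) (hd : 2 ≤ d) (κ : Fin (d+1) → ℝ) (hκ : ∀ i, 0 ≤ κ i)
    (f g : (Fin d → ℝ) → ℝ)
    (hf : ContDiffOn ℝ 2 f (Splx d)) (hg : ContDiffOn ℝ 2 g (Splx d)) :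
    -∫ x in Splx d, Dk κ f x * g x * Wk κ x =
      (∫ x in Splx d, xgrad f x * xgrad g x * (1 - ∑ k, x k) * Wk κ x / (∑ k, x k)) +
      ∑ i, ∑ j ∈ Finset.univ.filter (fun j => i < j),
        ∫ x in Splx d, pdd i j f x * pdd i j g x * x i * x j * Wk κ x / (∑ k, x k) := by
  have hd0 : 0 < d := by omega
  have hm := isOpen_interiorSplx (d := d).measurableSet
  simp only [setIntegral_splx hd0]
  have eg := ExtendsContinuously.of_continuousOn hg.continuousOn
  have eW := ExtendsContinuously.of_continuousOn (continuous_Wk hκ).continuousOn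
  have exf := extendsContinuously_xgrad hf
  have exg := extendsContinuously_xgrad hg
  have ef := fun i => extendsContinuously_pd i hf
  have eg' := fun i => extendsContinuously_pd i hg
  have hD : IntegrableOn (fun x => Dk κ f x * g x * Wk κ x) (interiorSplx d) :=
    (((extendsContinuously_Dk κ hf).mul eg).mul eW).integrableOn
  have hB : IntegrableOn (fun x => (∑ i, x i * pd i f x * pd i g x - xgrad f x * xgrad g x)
      * Wk κ x) (interiorSplx d) :=
    ((((ExtendsContinuously.sum _ fun i _ =>
      (((ExtendsContinuously.coord i).mul (ef i)).mul (eg' i))).sub (exf.mul exg)).mul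
        eW)).integrableOn
  have hR : IntegrableOn (fun x => xgrad f x * xgrad g x * (1 - ∑ k, x k) * Wk κ x / (∑ k, x k))
      (interiorSplx d) := by
    have : (fun x => xgrad f x * xgrad g x * (1 - ∑ k, x k) * Wk κ x / (∑ k, x k)) =
        fun x => ∑ i, x i / (∑ k, x k) *
          (pd i f x * xgrad g x * (1 - ∑ k, x k) * Wk κ x) := by
      funext x
      rw [xgrad.eq_def f]
      simp only [Finset.sum_mul, Finset.sum_div]
      exact Finset.sum_congr rfl fun i _ => by ring
    rw [this]
    refine integrable_finsetSum _ fun i _ =>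
      ExtendsContinuously.integrableOn_coord_div_sum_mul ?_ hd0 i
    exact (((ef i).mul exg).mul ((ExtendsContinuously.const 1).sub
      (.sum _ fun k _ => .coord k))).mul eW
  have hA : ∀ i j, IntegrableOn
      (fun x => pdd i j f x * pdd i j g x * x i * x j * Wk κ x / (∑ k, x k))
      (interiorSplx d) := by
    intro i j
    have : (fun x => pdd i j f x * pdd i j g x * x i * x j * Wk κ x / (∑ k, x k)) =
        fun x => x i / (∑ k, x k) * (pdd i j f x * pdd i j g x * x j * Wk κ x) := by
      funext x
      ring
    rw [this]
    refine ExtendsContinuously.integrableOn_coord_div_sum_mul ?_ hd0 i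
    exact ((((ef i).sub (ef j)).mul ((eg' i).sub (eg' j))).mul (.coord j)).mul eW
  have hgreen := integral_Dk_add_dirichlet hκ hf hg
  rw [integral_add hD hB] at hgreen
  rw [neg_eq_of_add_eq_zero_right hgreen, ← setIntegral_congr_fun hm fun x hx =>
    dirichlet_decomposition (f := f) (g := g) (Wk κ x) (sum_pos_of_mem_interiorSplx hd0 hx).ne',
    integral_add hR (integrable_finsetSum _ fun i _ => integrable_finsetSum _ fun j _ => hA i j),
    integral_finsetSum _ fun i _ => integrable_finsetSum _ fun j _ => hA i j]
  congr 1
  exact Finset.sum_congr rfl fun i _ => integral_finsetSum _ fun j _ => hA i j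
end
end
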